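/- arXiv:1708.09547 — 6 statements merged into one kernel-verified Lean document; each statement's English description precedes it below -/
import Mathlib

section
/- Let m₋, m₊ ∈ ℤ + 1/2 with m₊ ≥ m₋ > 0 and m₊ > 1/2, and set N = m₊ − 1/2 ∈ ℤ≥1. On the root system R₀ of type B_N assign the parameters (m₋(α), m₊(α)) = (m₋, m₊ − 1) to the short roots ±e_i and (m₋(α), m₊(α)) = (0, 1) to the long roots ±e_i ± e_j. Then the point r = (v, v³, v⁵, …, v^{2N−1}) (i.e. r_i = v^{2i−1}) is a residual point; more precisely #{α ∈ R₀ : α(r) = q^{−m₊(α)}} = N (consisting of the N−1 long roots e_{i+1} − e_i and the short root −e_N), while the sets {α ∈ R₀ : α(r) = −q^{−m₋(α)}}, {α ∈ R₀ : α(r) = 1} and {α ∈ R₀ : α(r) = −1} are all empty. (This verifies that the image of the spectral transfer morphism φ_{T,m₋,m₊} is a residual coset.) -/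
/-!
STATEMENT 0. The image of the spectral transfer morphism `φ_{T,m₋,m₊}` is a residual coset:
for half-integers `m₋ = a + 1/2`, `m₊ = N + 1/2` with `m₊ ≥ m₋ > 0`, `m₊ > 1/2`, the point
`r = (v, v³, …, v^{2N-1})` in `(ℂ^×)^N` is a residual point for the type `B_N` root system with
parameters `(m₋, m₊ - 1)` on short roots and `(0,1)` on long roots.
-/

open Finset
open scoped Classical

noncomputable section

/-- The short roots `±e_i` of the root system of type `B_n`, realized in `ℤ^n`. -/
def Bshort (n : ℕ) : Finset (Fin n → ℤ) :=
  Finset.image (fun p : Fin n × Bool => Pi.single p.1 (if p.2 then (1 : ℤ) else -1))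
    Finset.univ

/-- The long roots `±e_i ± e_j` (`i ≠ j`) of the root system of type `B_n`. -/
def Blong (n : ℕ) : Finset (Fin n → ℤ) :=
  Finset.image
    (fun p : (Fin n × Fin n) × Bool × Bool =>
      Pi.single p.1.1 (if p.2.1 then (1 : ℤ) else -1) +
        Pi.single p.1.2 (if p.2.2 then (1 : ℤ) else -1))
    (Finset.univ.filter fun p : (Fin n × Fin n) × Bool × Bool => p.1.1 ≠ p.1.2)

/-- All roots of the root system of type `B_n`. -/
def BRoots (n : ℕ) : Finset (Fin n → ℤ) := Bshort n ∪ Blong n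

/-- Evaluation of a root `α` at a point `t ∈ (ℂ^×)^n` : `α(t) = ∏ i, t i ^ (α i)`. -/
def evalRoot {n : ℕ} (α : Fin n → ℤ) (t : Fin n → ℂ) : ℂ := ∏ i, t i ^ (α i)

/-- The exponent of `v` in the value of `α` at the point `(v, v³, v⁵, …)`. -/
def rootExponent {n : ℕ} (α : Fin n → ℤ) : ℤ := ∑ i : Fin n, (2 * (i : ℤ) + 1) * α i

lemma rootExponent_add {n : ℕ} (α β : Fin n → ℤ) :
    rootExponent (α + β) = rootExponent α + rootExponent β := by
  simp [rootExponent, mul_add, Finset.sum_add_distrib]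

lemma rootExponent_single {n : ℕ} (i : Fin n) (c : ℤ) :
    rootExponent (Pi.single i c) = (2 * (i : ℤ) + 1) * c := by
  simp [rootExponent, Pi.single_apply]

lemma evalRoot_eq_zpow_rootExponent {v : ℝ} (hv : v ≠ 0) {n : ℕ} {r : Fin n → ℂ}
    (hr : ∀ i, r i = (v : ℂ) ^ (2 * (i : ℕ) + 1)) (α : Fin n → ℤ) :
    evalRoot α r = ((v ^ rootExponent α : ℝ) : ℂ) := by
  have key (s : Finset (Fin n)) :
      ∏ i ∈ s, r i ^ α i = (v : ℂ) ^ (∑ i ∈ s, (2 * (i : ℤ) + 1) * α i) := by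
    induction s using Finset.induction_on with
    | empty => simp
    | insert i s hi ih =>
      rw [Finset.prod_insert hi, Finset.sum_insert hi, ih,
        zpow_add₀ (Complex.ofReal_ne_zero.2 hv), zpow_mul, hr]
      norm_cast
  rw [evalRoot, key, rootExponent, Complex.ofReal_zpow]

lemma mem_Bshort_iff {n : ℕ} {α : Fin n → ℤ} :
    α ∈ Bshort n ↔ ∃ i, ∃ s : ℤ, (s = 1 ∨ s = -1) ∧ α = Pi.single i s := by
  simp only [Bshort, Finset.mem_image, Finset.mem_univ, true_and, Prod.exists, Bool.exists_bool]
  constructor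
  · rintro ⟨i, h | h⟩
    · exact ⟨i, -1, Or.inr rfl, by simpa using h.symm⟩
    · exact ⟨i, 1, Or.inl rfl, by simpa using h.symm⟩
  · rintro ⟨i, s, rfl | rfl, rfl⟩
    · exact ⟨i, Or.inr (by simp)⟩
    · exact ⟨i, Or.inl (by simp)⟩

lemma mem_Blong_iff {n : ℕ} {α : Fin n → ℤ} :
    α ∈ Blong n ↔ ∃ i j, ∃ s t : ℤ, i ≠ j ∧ (s = 1 ∨ s = -1) ∧ (t = 1 ∨ t = -1) ∧
      α = Pi.single i s + Pi.single j t := by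
  simp only [Blong, Finset.mem_image, Finset.mem_filter, Finset.mem_univ, true_and, Prod.exists]
  constructor
  · rintro ⟨i, j, b, c, hij, rfl⟩
    refine ⟨i, j, _, _, hij, ?_, ?_, rfl⟩
    · cases b <;> simp
    · cases c <;> simp
  · rintro ⟨i, j, s, t, hij, hs, ht, rfl⟩
    refine ⟨i, j, decide (s = 1), decide (t = 1), hij, ?_⟩
    rcases hs with rfl | rfl <;> rcases ht with rfl | rfl <;> simp

lemma odd_rootExponent_of_mem_Bshort {n : ℕ} {α : Fin n → ℤ} (h : α ∈ Bshort n) :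
    Odd (rootExponent α) := by
  obtain ⟨i, s, hs, rfl⟩ := mem_Bshort_iff.1 h
  rw [rootExponent_single]
  rcases hs with rfl | rfl
  · exact ⟨i, by ring⟩
  · exact ⟨-i - 1, by ring⟩

lemma even_rootExponent_of_mem_Blong {n : ℕ} {α : Fin n → ℤ} (h : α ∈ Blong n) :
    Even (rootExponent α) := by
  obtain ⟨i, j, s, t, -, hs, ht, rfl⟩ := mem_Blong_iff.1 h
  rw [rootExponent_add, rootExponent_single, rootExponent_single, Int.even_iff]
  rcases hs with rfl | rfl <;> rcases ht with rfl | rfl <;> omega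

lemma notMem_Bshort_of_mem_Blong {n : ℕ} {α : Fin n → ℤ} (h : α ∈ Blong n) : α ∉ Bshort n :=
  fun h' => Int.not_odd_iff_even.2 (even_rootExponent_of_mem_Blong h)
    (odd_rootExponent_of_mem_Bshort h')

lemma rootExponent_ne_zero {n : ℕ} {α : Fin n → ℤ} (h : α ∈ BRoots n) : rootExponent α ≠ 0 := by
  rcases Finset.mem_union.1 h with h | h
  · intro h0
    simpa [h0] using odd_rootExponent_of_mem_Bshort h
  · obtain ⟨i, j, s, t, hij, hs, ht, rfl⟩ := mem_Blong_iff.1 h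
    rw [rootExponent_add, rootExponent_single, rootExponent_single]
    have := Fin.val_ne_of_ne hij
    rcases hs with rfl | rfl <;> rcases ht with rfl | rfl <;> omega

/-- The simple root `e_i - e_{i+1}`. -/
def simpleLongRoot {n : ℕ} (i : Fin n) : Fin (n + 1) → ℤ :=
  Pi.single i.castSucc 1 + Pi.single i.succ (-1)

lemma simpleLongRoot_mem_Blong {n : ℕ} (i : Fin n) : simpleLongRoot i ∈ Blong (n + 1) :=
  mem_Blong_iff.2 ⟨_, _, _, _, Fin.castSucc_lt_succ.ne, Or.inl rfl, Or.inr rfl, rfl⟩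

lemma rootExponent_simpleLongRoot {n : ℕ} (i : Fin n) :
    rootExponent (simpleLongRoot i) = -2 := by
  rw [simpleLongRoot, rootExponent_add, rootExponent_single, rootExponent_single]
  simp
  ring

lemma simpleLongRoot_injective {n : ℕ} : Function.Injective (simpleLongRoot (n := n)) := by
  intro i k h
  by_contra hik
  have h1 := congrFun h i.castSucc
  simp [simpleLongRoot, Pi.single_apply, hik, Fin.castSucc_lt_succ.ne] at h1
  split_ifs at h1
  simp at h1

lemma mem_Bshort_and_rootExponent_eq_iff {n : ℕ} {α : Fin (n + 1) → ℤ} :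
    α ∈ Bshort (n + 1) ∧ rootExponent α = -(2 * (n : ℤ) + 1) ↔
      α = Pi.single (Fin.last n) (-1) := by
  constructor
  · rintro ⟨hα, h⟩
    obtain ⟨i, s, hs, rfl⟩ := mem_Bshort_iff.1 hα
    rw [rootExponent_single] at h
    rcases hs with rfl | rfl
    · omega
    · obtain rfl : i = Fin.last n := Fin.ext (by simp; omega)
      rfl
  · rintro rfl
    refine ⟨mem_Bshort_iff.2 ⟨_, _, Or.inr rfl, rfl⟩, ?_⟩
    rw [rootExponent_single]
    simp

lemma mem_Blong_and_rootExponent_eq_iff {n : ℕ} {α : Fin (n + 1) → ℤ} :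
    α ∈ Blong (n + 1) ∧ rootExponent α = -2 ↔ ∃ i, simpleLongRoot i = α := by
  constructor
  · rintro ⟨hα, h⟩
    obtain ⟨i, j, s, t, hij, hs, ht, rfl⟩ := mem_Blong_iff.1 hα
    have hij' := Fin.val_ne_of_ne hij
    rw [rootExponent_add, rootExponent_single, rootExponent_single] at h
    rcases hs with rfl | rfl <;> rcases ht with rfl | rfl
    · omega
    · have hlt : (i : ℕ) < n := by omega
      refine ⟨⟨i, hlt⟩, ?_⟩
      have hj : j = Fin.succ ⟨i, hlt⟩ := Fin.ext (by simp; omega)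
      rw [hj]
      rfl
    · have hlt : (j : ℕ) < n := by omega
      refine ⟨⟨j, hlt⟩, ?_⟩
      have hi : i = Fin.succ ⟨j, hlt⟩ := Fin.ext (by simp; omega)
      rw [hi]
      exact add_comm _ _
    · omega
  · rintro ⟨i, rfl⟩
    exact ⟨simpleLongRoot_mem_Blong i, rootExponent_simpleLongRoot i⟩

lemma card_filter_rootExponent {n : ℕ} :
    ((BRoots (n + 1)).filter fun α => rootExponent α =
      if α ∈ Bshort (n + 1) then -(2 * (n : ℤ) + 1) else -2).card = n + 1 := by
  have hset : ((BRoots (n + 1)).filter fun α => rootExponent α =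
      if α ∈ Bshort (n + 1) then -(2 * (n : ℤ) + 1) else -2) =
      insert (Pi.single (Fin.last n) (-1)) (Finset.univ.image simpleLongRoot) := by
    ext α
    rw [Finset.mem_insert, Finset.mem_image, ← mem_Bshort_and_rootExponent_eq_iff]
    simp only [Finset.mem_univ, true_and]
    rw [← mem_Blong_and_rootExponent_eq_iff, Finset.mem_filter, BRoots, Finset.mem_union]
    by_cases hs : α ∈ Bshort (n + 1)
    · have hl : α ∉ Blong (n + 1) := fun hl => notMem_Bshort_of_mem_Blong hl hs
      simp [hs, hl]
    · simp [hs]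
  rw [hset, Finset.card_insert_of_notMem, Finset.card_image_of_injective _ simpleLongRoot_injective,
    Finset.card_univ, Fintype.card_fin]
  simp only [Finset.mem_image, Finset.mem_univ, true_and]
  rintro ⟨i, hi⟩
  exact notMem_Bshort_of_mem_Blong (simpleLongRoot_mem_Blong i)
    (hi ▸ mem_Bshort_iff.2 ⟨_, _, Or.inr rfl, rfl⟩)

/-- the point `r_i = v^{2i-1}` is a residual point for type `B_N` with
parameters `(m₋, m₊ - 1)` on short roots and `(0,1)` on long roots: exactly `N` roots take
the value `q^{-m₊(α)}`, and the sets of roots taking the values `-q^{-m₋(α)}`, `1`, `-1`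
are all empty.  (Here `q = v²`, so `q^{-(m₊-1)} = v^{-(2N-1)}`, `q^{-1} = v^{-2}`,
`q^{-m₋} = v^{-(2a+1)}` and `q^{-0} = 1`.) -/
theorem statement0 (v : ℝ) (hv : 1 < v) (N : ℕ) (hN : 1 ≤ N)
    (mminus mplus : ℚ) (a : ℤ) (hmm : mminus = a + 1 / 2) (hmp : mplus = N + 1 / 2)
    (h0 : 0 < mminus) (hle : mminus ≤ mplus)
    (r : Fin N → ℂ) (hr : ∀ i, r i = (v : ℂ) ^ (2 * (i : ℕ) + 1)) :
    ((BRoots N).filter fun α => evalRoot α r =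
        (if α ∈ Bshort N then (v : ℂ) ^ (-(2 * (N : ℤ) - 1)) else (v : ℂ) ^ (-2 : ℤ))).card = N
    ∧ ((BRoots N).filter fun α => evalRoot α r =
        -(if α ∈ Bshort N then (v : ℂ) ^ (-(2 * a + 1)) else 1)) = ∅
    ∧ ((BRoots N).filter fun α => evalRoot α r = 1) = ∅
    ∧ ((BRoots N).filter fun α => evalRoot α r = -1) = ∅ := by
  have hv0 : 0 < v := by linarith
  have heval := evalRoot_eq_zpow_rootExponent hv0.ne' hr
  have hpow (k l : ℤ) : ((v ^ k : ℝ) : ℂ) = (v : ℂ) ^ l ↔ k = l := by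
    rw [← Complex.ofReal_zpow, Complex.ofReal_inj]
    exact zpow_right_inj₀ hv0 hv.ne'
  have hneg (k l : ℤ) : ((v ^ k : ℝ) : ℂ) ≠ -(v : ℂ) ^ l := by
    rw [← Complex.ofReal_zpow, ← Complex.ofReal_neg, Ne, Complex.ofReal_inj]
    have := zpow_pos hv0 k
    have := zpow_pos hv0 l
    linarith
  refine ⟨?_, ?_, ?_, ?_⟩
  · obtain ⟨n, rfl⟩ := Nat.exists_eq_add_of_le' hN
    convert card_filter_rootExponent (n := n) using 3 with α
    rw [heval, ← apply_ite ((v : ℂ) ^ ·), hpow]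
    push_cast
    ring_nf
  · refine Finset.filter_eq_empty_iff.2 fun α _ => ?_
    rw [heval]
    split_ifs
    · exact hneg _ _
    · simpa using hneg (rootExponent α) 0
  · refine Finset.filter_eq_empty_iff.2 fun α hα => ?_
    rw [heval, ← zpow_zero (v : ℂ), hpow]
    exact rootExponent_ne_zero hα
  · refine Finset.filter_eq_empty_iff.2 fun α _ => ?_
    rw [heval]
    simpa using hneg (rootExponent α) 0
end
end

section
/- Let m₋, m₊ ∈ ℤ + 1/2 with m₊ ≥ m₋ > 0 and m₊ > 1/2, set N = m₊ − 1/2, and let r = (v, v³, …, v^{2N−1}) be the residual point of the type B_N root system with parameters (m₋, m₊ − 1) on short roots and (0, 1) on long roots. Then there exist a sign ε₀ ∈ {1, −1} and an integer k such that Res(r) = ε₀ · v^k · (q − 1)^N / ∏_{j = m₋ − m₊ + 1}^{m₋ + m₊ − 1} (q^j + 1), the product running over the 2N consecutive integers j with m₋ − m₊ + 1 ≤ j ≤ m₋ + m₊ − 1. -/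
/-!
STATEMENT 1. The residue of the μ-function (for type `B_N` with parameters `(m₋, m₊-1)` on
short roots and `(0,1)` on long roots) at the residual point `r = (v, v³, …, v^{2N-1})` equals,
up to a sign and a power of `v`, `(q-1)^N / ∏_{j=m₋-m₊+1}^{m₋+m₊-1} (q^j + 1)`.
-/

open Finset
open scoped Classical

noncomputable section

/-- The regularized residue of the μ-function (normalization `d = 1`) at a point `r`.
Here `qmm α = q^{-m₋(α)}` and `qmp α = q^{-m₊(α)}` are the parameter values attached to
the root `α`. -/
def ResMu {n : ℕ} (qmm qmp : (Fin n → ℤ) → ℂ) (r : Fin n → ℂ) : ℂ :=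
  ((∏ α ∈ (BRoots n).filter fun α => evalRoot α r ≠ 1, (1 - (evalRoot α r)⁻¹)) *
      ∏ α ∈ (BRoots n).filter fun α => evalRoot α r ≠ -1, (1 + (evalRoot α r)⁻¹)) /
    ((∏ α ∈ (BRoots n).filter fun α => evalRoot α r ≠ -qmm α,
        (1 + qmm α * (evalRoot α r)⁻¹)) *
      ∏ α ∈ (BRoots n).filter fun α => evalRoot α r ≠ qmp α,
        (1 - qmp α * (evalRoot α r)⁻¹))

/-- `A` and `B` agree up to a sign and an integer power of `x`. -/
def MonomialEquiv (x A B : ℂ) : Prop :=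
  ∃ ε : ℂ, (ε = 1 ∨ ε = -1) ∧ ∃ k : ℤ, A = ε * x ^ k * B

namespace MonomialEquiv

variable {x A B C D : ℂ}

lemma refl (x A : ℂ) : MonomialEquiv x A A := ⟨1, Or.inl rfl, 0, by simp⟩

lemma trans (hx : x ≠ 0) (h : MonomialEquiv x A B) (h' : MonomialEquiv x B C) :
    MonomialEquiv x A C := by
  obtain ⟨ε, hε, k, rfl⟩ := h
  obtain ⟨δ, hδ, l, rfl⟩ := h'
  refine ⟨ε * δ, ?_, k + l, by rw [zpow_add₀ hx]; ring⟩
  rcases hε with rfl | rfl <;> rcases hδ with rfl | rfl <;> simp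

lemma mul (hx : x ≠ 0) (h : MonomialEquiv x A B) (h' : MonomialEquiv x C D) :
    MonomialEquiv x (A * C) (B * D) := by
  obtain ⟨ε, hε, k, rfl⟩ := h
  obtain ⟨δ, hδ, l, rfl⟩ := h'
  refine ⟨ε * δ, ?_, k + l, by rw [zpow_add₀ hx]; ring⟩
  rcases hε with rfl | rfl <;> rcases hδ with rfl | rfl <;> simp

lemma inv (h : MonomialEquiv x A B) : MonomialEquiv x A⁻¹ B⁻¹ := by
  obtain ⟨ε, hε, k, rfl⟩ := h
  refine ⟨ε, hε, -k, ?_⟩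
  rw [mul_inv, mul_inv, zpow_neg]
  rcases hε with rfl | rfl <;> simp

lemma div (hx : x ≠ 0) (h : MonomialEquiv x A B) (h' : MonomialEquiv x C D) :
    MonomialEquiv x (A / C) (B / D) := by
  simpa only [div_eq_mul_inv] using h.mul hx h'.inv

lemma prod {ι : Type*} (hx : x ≠ 0) (s : Finset ι) {f g : ι → ℂ}
    (h : ∀ i ∈ s, MonomialEquiv x (f i) (g i)) :
    MonomialEquiv x (∏ i ∈ s, f i) (∏ i ∈ s, g i) := by
  classical
  induction s using Finset.induction_on with
  | empty => simpa using refl x 1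
  | insert i s hi ih =>
    rw [prod_insert hi, prod_insert hi]
    exact (h i (mem_insert_self i s)).mul hx (ih fun j hj => h j (mem_insert_of_mem hj))

end MonomialEquiv

lemma single_ne_single_add_single {n : ℕ} {i i' j' : Fin n} {s s' t' : ℤ} (hs' : s' ≠ 0)
    (ht' : t' ≠ 0) (hij : i' ≠ j') :
    (Pi.single i s : Fin n → ℤ) ≠ Pi.single i' s' + Pi.single j' t' := by
  intro h
  have h1 := congrFun h i'
  have h2 := congrFun h j'
  simp only [Pi.add_apply, Pi.single_apply] at h1 h2
  grind

lemma disjoint_Bshort_Blong (n : ℕ) : Disjoint (Bshort n) (Blong n) := by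
  rw [Finset.disjoint_left]
  intro α h1 h2
  simp only [Bshort, Blong, mem_image, mem_univ, true_and, mem_filter] at h1 h2
  obtain ⟨p, rfl⟩ := h1
  obtain ⟨p', hp', h⟩ := h2
  exact single_ne_single_add_single (by split_ifs <;> simp) (by split_ifs <;> simp) hp' h.symm

lemma prod_Bshort {n : ℕ} (F : (Fin n → ℤ) → ℂ) :
    ∏ α ∈ Bshort n, F α = ∏ i : Fin n, F (Pi.single i 1) * F (Pi.single i (-1)) := by
  rw [Bshort, prod_image, ← univ_product_univ, prod_product]
  · simp
  · rintro ⟨i, s⟩ - ⟨j, t⟩ - h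
    have h1 := congrFun h i
    have h2 := congrFun h j
    simp only [Pi.single_apply] at h1 h2
    grind

lemma Blong_eq_image_sigma (n : ℕ) :
    Blong n = Finset.image
      (fun p : (_ : Fin n) × (Fin n × Bool × Bool) =>
        Pi.single p.1 (if p.2.2.1 then (1 : ℤ) else -1) +
          Pi.single p.2.1 (if p.2.2.2 then (1 : ℤ) else -1))
      (Finset.univ.sigma fun i => (Finset.univ.filter (· < i)) ×ˢ Finset.univ) := by
  ext α
  simp only [Blong, mem_image, mem_filter, mem_univ, true_and, mem_sigma, mem_product, and_true]
  constructor
  · rintro ⟨⟨⟨i, j⟩, s, t⟩, hij, rfl⟩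
    rcases lt_or_gt_of_ne hij with h | h
    · exact ⟨⟨j, i, t, s⟩, h, add_comm _ _⟩
    · exact ⟨⟨i, j, s, t⟩, h, rfl⟩
  · rintro ⟨⟨i, j, s, t⟩, hij, rfl⟩
    exact ⟨⟨⟨i, j⟩, s, t⟩, ne_of_gt hij, rfl⟩

lemma prod_Blong {n : ℕ} (F : (Fin n → ℤ) → ℂ) :
    ∏ α ∈ Blong n, F α = ∏ i : Fin n, ∏ j ∈ Finset.univ.filter (· < i),
      (F (Pi.single i 1 + Pi.single j 1) * F (Pi.single i 1 + Pi.single j (-1)) *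
        (F (Pi.single i (-1) + Pi.single j 1) * F (Pi.single i (-1) + Pi.single j (-1)))) := by
  rw [Blong_eq_image_sigma, prod_image, prod_sigma]
  · refine prod_congr rfl fun i _ => ?_
    rw [prod_product]
    refine prod_congr rfl fun j _ => ?_
    rw [← univ_product_univ, prod_product]
    simp
  · rintro ⟨i, j, s, t⟩ hp ⟨i', j', s', t'⟩ hp' h
    simp only [coe_sigma, Set.mem_sigma_iff, coe_product, Set.mem_prod, coe_filter, mem_univ,
      coe_univ, Set.mem_univ, Set.mem_ofPred_eq, true_and, and_true] at hp hp'
    have h1 := congrFun h i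
    have h2 := congrFun h j
    have h3 := congrFun h i'
    have h4 := congrFun h j'
    simp only [Pi.add_apply, Pi.single_apply] at h1 h2 h3 h4
    have hi : i = i' := by grind
    subst hi
    have hj : j = j' := by grind
    subst hj
    have hs : s = s' := by grind
    have ht : t = t' := by grind
    rw [hs, ht]

lemma evalRoot_single {n : ℕ} (i : Fin n) (s : ℤ) (t : Fin n → ℂ) :
    evalRoot (Pi.single i s) t = t i ^ s := by
  rw [evalRoot, prod_eq_single i] <;> simp +contextual

lemma evalRoot_add {n : ℕ} (α β : Fin n → ℤ) {t : Fin n → ℂ} (ht : ∀ i, t i ≠ 0) :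
    evalRoot (α + β) t = evalRoot α t * evalRoot β t := by
  simp only [evalRoot, ← prod_mul_distrib]
  exact prod_congr rfl fun i _ => zpow_add₀ (ht i) _ _

lemma prod_range_add_mul_sub (g : ℕ → ℂ) (i : ℕ) :
    ∏ j ∈ range i, g (i + j) * g (i - 1 - j) = ∏ k ∈ range (2 * i), g k := by
  rw [prod_mul_distrib, prod_range_reflect, two_mul, prod_range_add, mul_comm]

lemma prod_filter_lt_fin {n : ℕ} (i : Fin n) (g : ℕ → ℂ) :
    ∏ j ∈ Finset.univ.filter (· < i), g (j : Fin n) = ∏ j ∈ range i, g j := by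
  rw [prod_filter]
  simp only [Fin.lt_def]
  rw [Fin.prod_univ_eq_prod_range (fun j => if j < (i : ℕ) then g j else 1) n, ← prod_filter]
  congr 1
  ext j
  simp only [mem_filter, mem_range]
  omega

/-- The product over all roots of a function of the root type and of the value at the point
`(x, x³, …, x^{2n-1})`. -/
lemma prod_BRoots_eq {n : ℕ} {x : ℂ} (hx : x ≠ 0) {r : Fin n → ℂ}
    (hr : ∀ i, r i = x ^ (2 * (i : ℕ) + 1)) {F : (Fin n → ℤ) → ℂ} {G H : ℂ → ℂ}
    (hs : ∀ α ∈ Bshort n, F α = G (evalRoot α r)) (hl : ∀ α ∈ Blong n, F α = H (evalRoot α r)) :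
    ∏ α ∈ BRoots n, F α =
      (∏ i ∈ range n, G (x ^ (2 * i + 1 : ℤ)) * G (x ^ (-(2 * i + 1) : ℤ))) *
        ∏ i ∈ range n, ∏ k ∈ range (2 * i),
          H (x ^ (2 * (k + 1) : ℤ)) * H (x ^ (-(2 * (k + 1)) : ℤ)) := by
  have hr' : ∀ i, r i = x ^ (2 * (i : ℕ) + 1 : ℤ) := fun i => by
    rw [hr]; exact_mod_cast rfl
  have hr0 : ∀ i, r i ≠ 0 := fun i => by rw [hr]; exact pow_ne_zero _ hx
  rw [BRoots, prod_union (disjoint_Bshort_Blong n), prod_congr rfl hs, prod_congr rfl hl,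
    prod_Bshort, prod_Blong]
  simp only [evalRoot_add _ _ hr0, evalRoot_single, hr', ← zpow_mul, ← zpow_add₀ hx]
  congr 1
  · rw [← Fin.prod_univ_eq_prod_range
      (fun i => G (x ^ (2 * i + 1 : ℤ)) * G (x ^ (-(2 * i + 1) : ℤ)))]
    simp
  · rw [← Fin.prod_univ_eq_prod_range (fun i => ∏ k ∈ range (2 * i),
          H (x ^ (2 * (k + 1) : ℤ)) * H (x ^ (-(2 * (k + 1)) : ℤ)))]
    refine prod_congr rfl fun i _ => ?_
    rw [← prod_range_add_mul_sub (fun k : ℕ =>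
          H (x ^ (2 * (k + 1) : ℤ)) * H (x ^ (-(2 * (k + 1)) : ℤ))), ← prod_filter_lt_fin i]
    refine prod_congr rfl fun j hj => ?_
    have hj' : (j : ℕ) < i := by simpa using hj
    have hc : ((i - 1 - j : ℕ) : ℤ) = i - 1 - j := by omega
    rw [hc]
    push_cast
    ring_nf

lemma prod_BRoots_monomialEquiv {n : ℕ} {x : ℂ} (hx : x ≠ 0) {r : Fin n → ℂ}
    (hr : ∀ i, r i = x ^ (2 * (i : ℕ) + 1)) {F : (Fin n → ℤ) → ℂ} (G H : ℂ → ℂ) (g h : ℕ → ℂ)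
    (hs : ∀ α ∈ Bshort n, F α = G (evalRoot α r)) (hl : ∀ α ∈ Blong n, F α = H (evalRoot α r))
    (hg : ∀ i < n,
      MonomialEquiv x (G (x ^ (2 * i + 1 : ℤ)) * G (x ^ (-(2 * i + 1) : ℤ))) (g i))
    (hh : ∀ k : ℕ,
      MonomialEquiv x (H (x ^ (2 * (k + 1) : ℤ)) * H (x ^ (-(2 * (k + 1)) : ℤ))) (h k)) :
    MonomialEquiv x (∏ α ∈ BRoots n, F α)
      ((∏ i ∈ range n, g i) * ∏ i ∈ range n, ∏ k ∈ range (2 * i), h k) := by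
  rw [prod_BRoots_eq hx hr hs hl]
  exact (MonomialEquiv.prod hx _ fun i hi => hg i (mem_range.1 hi)).mul hx
    (MonomialEquiv.prod hx _ fun i _ => MonomialEquiv.prod hx _ fun k _ => hh k)

lemma monomialEquiv_one_sub {x : ℂ} (k : ℤ) : MonomialEquiv x (1 - x ^ k) (x ^ k - 1) :=
  ⟨-1, Or.inr rfl, 0, by simp⟩

lemma monomialEquiv_one_sub_neg {x : ℂ} (hx : x ≠ 0) (k : ℤ) :
    MonomialEquiv x (1 - x ^ (-k)) (x ^ k - 1) :=
  ⟨1, Or.inl rfl, -k, by rw [mul_sub, one_mul, ← zpow_add₀ hx]; simp⟩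

lemma monomialEquiv_one_add {x : ℂ} (k : ℤ) : MonomialEquiv x (1 + x ^ k) (x ^ k + 1) :=
  ⟨1, Or.inl rfl, 0, by simp [add_comm]⟩

lemma monomialEquiv_one_add_neg {x : ℂ} (hx : x ≠ 0) (k : ℤ) :
    MonomialEquiv x (1 + x ^ (-k)) (x ^ k + 1) :=
  ⟨1, Or.inl rfl, -k, by rw [mul_add, one_mul, ← zpow_add₀ hx]; simp [add_comm]⟩

lemma prod_Icc_eq_prod_range (a : ℤ) (n : ℕ) (g : ℤ → ℂ) :
    ∏ j ∈ Finset.Icc (a - n + 1) (a + n), g j =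
      ∏ i ∈ range n, g (a + i + 1) * g (a - i) := by
  induction n with
  | zero => simp
  | succ n ih =>
    have h : Finset.Icc (a - (n + 1 : ℕ) + 1) (a + (n + 1 : ℕ)) =
        insert (a + n + 1) (insert (a - n) (Finset.Icc (a - n + 1) (a + n))) := by
      ext j
      simp only [mem_insert, mem_Icc]
      omega
    rw [h, prod_insert, prod_insert, prod_range_succ, ih]
    · ring
    · simp
    · simp only [mem_insert, mem_Icc]
      omega

lemma prod_range_shift_mul (b : ℕ → ℂ) (n : ℕ) :
    (∏ k ∈ range (n + 1), b (k + 1) ^ 2) * b (n + 2) =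
      b 1 * b (n + 1) * ∏ k ∈ range (n + 1), b (k + 2) * (if k = 0 then 1 else b k) := by
  induction n with
  | zero => simp only [zero_add, prod_range_one, if_true]; ring
  | succ n ih =>
    rw [prod_range_succ, prod_range_succ _ (n + 1), if_neg n.succ_ne_zero]
    linear_combination b (n + 2) * b (n + 3) * ih

lemma prod_residue_identity (b : ℕ → ℂ) (n : ℕ) :
    (∏ i ∈ range (n + 1), b (2 * i + 1) ^ 2) *
        ∏ i ∈ range (n + 1), ∏ k ∈ range (2 * i), b (k + 1) ^ 2 =
      b 1 ^ (n + 1) * ((∏ k ∈ range (2 * n + 1), b (k + 1)) *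
        ∏ i ∈ range (n + 1), ∏ k ∈ range (2 * i), b (k + 2) * (if k = 0 then 1 else b k)) := by
  induction n with
  | zero => simp; ring
  | succ n ih =>
    have h := prod_range_shift_mul b (2 * n + 1)
    rw [prod_range_succ _ (n + 1), prod_range_succ _ (n + 1), prod_range_succ _ (n + 1),
      show 2 * (n + 1) + 1 = 2 * n + 1 + 1 + 1 by ring, prod_range_succ _ (2 * n + 1 + 1),
      prod_range_succ _ (2 * n + 1), show 2 * (n + 1) = 2 * n + 1 + 1 by ring, pow_succ (b 1)]
    simp only [show 2 * n + 1 + 1 + 1 = 2 * n + 1 + 2 by ring] at h ⊢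
    generalize (∏ k ∈ range (2 * n + 1 + 1), b (k + 1) ^ 2) = A at h ⊢
    generalize (∏ k ∈ range (2 * n + 1 + 1), b (k + 2) * (if k = 0 then 1 else b k)) = B at h ⊢
    generalize b (2 * n + 1 + 2) = c at h ⊢
    linear_combination A * c ^ 2 * ih + (b 1 ^ (n + 1) * ((∏ k ∈ range (2 * n + 1), b (k + 1)) *
        ∏ i ∈ range (n + 1), ∏ k ∈ range (2 * i), b (k + 2) * (if k = 0 then 1 else b k))) * c * h

lemma prod_range_short (b : ℕ → ℂ) (n : ℕ) :
    ∏ i ∈ range (n + 1), b (n + 1 + i) * (if i = n then 1 else b (n - i)) =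
      ∏ k ∈ range (2 * n + 1), b (k + 1) := by
  rw [prod_mul_distrib, show 2 * n + 1 = n + (n + 1) by ring, prod_range_add _ n (n + 1),
    prod_range_succ (fun i => if i = n then 1 else b (n - i)), if_pos rfl, mul_one, mul_comm,
    ← prod_range_reflect (fun k => b (k + 1))]
  refine congrArg₂ (· * ·) (prod_congr rfl fun i hi => ?_) (prod_congr rfl fun i _ => ?_)
  · rw [mem_range] at hi
    rw [if_neg hi.ne]
    congr 1
    omega
  · congr 1
    omega

lemma ofReal_zpow_eq_zpow_iff {v : ℝ} (hv : 1 < v) (k l : ℤ) :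
    (v : ℂ) ^ k = (v : ℂ) ^ l ↔ k = l := by
  norm_cast
  exact zpow_right_inj₀ (by linarith) hv.ne'

lemma ofReal_zpow_ne_neg_zpow {v : ℝ} (hv : 1 < v) (k l : ℤ) :
    (v : ℂ) ^ k ≠ -(v : ℂ) ^ l := by
  norm_cast
  have h1 : 0 < v ^ k := zpow_pos (by linarith) k
  have h2 : 0 < v ^ l := zpow_pos (by linarith) l
  linarith

lemma ResMu_monomialEquiv {v : ℝ} (hv : 1 < v) (n : ℕ) (a : ℤ) {r : Fin (n + 1) → ℂ}
    (hr : ∀ i, r i = (v : ℂ) ^ (2 * (i : ℕ) + 1)) :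
    MonomialEquiv (v : ℂ)
      (ResMu (fun α => if α ∈ Bshort (n + 1) then (v : ℂ) ^ (-(2 * a + 1)) else 1)
        (fun α => if α ∈ Bshort (n + 1) then (v : ℂ) ^ (-(2 * ((n + 1 : ℕ) : ℤ) - 1))
          else (v : ℂ) ^ (-2 : ℤ)) r)
      (((v : ℂ) ^ 2 - 1) ^ (n + 1) /
        ∏ j ∈ Finset.Icc (a - (n + 1 : ℕ) + 1) (a + (n + 1 : ℕ)), (((v : ℂ) ^ 2) ^ j + 1)) := by
  have hinj := ofReal_zpow_eq_zpow_iff hv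
  have hneg := ofReal_zpow_ne_neg_zpow hv
  have hx : (v : ℂ) ≠ 0 := by exact_mod_cast (by linarith : v ≠ 0)
  generalize (v : ℂ) = x at *
  have hone (k : ℤ) : x ^ k = 1 ↔ k = 0 := by simpa using hinj k 0
  have hnegone (k : ℤ) : x ^ k ≠ -1 := by simpa using hneg k 0
  have hadd (k : ℤ) : x ^ k + 1 ≠ 0 := fun h => hnegone k (eq_neg_of_add_eq_zero_left h)
  have hnot : ∀ α ∈ Blong (n + 1), α ∉ Bshort (n + 1) := fun α h h' =>
    Finset.disjoint_left.1 (disjoint_Bshort_Blong _) h' h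
  set b : ℕ → ℂ := fun m => x ^ (2 * m : ℤ) - 1 with hb
  have hb0 (m : ℕ) : b (m + 1) ≠ 0 := by
    rw [hb]
    simp only [ne_eq, sub_eq_zero, hone]
    omega
  rw [ResMu]
  simp only [prod_filter]
  have h1 := prod_BRoots_monomialEquiv hx hr
    (F := fun α => if evalRoot α r ≠ 1 then 1 - (evalRoot α r)⁻¹ else 1)
    (fun z => if z ≠ 1 then 1 - z⁻¹ else 1) (fun z => if z ≠ 1 then 1 - z⁻¹ else 1)
    (fun i => (x ^ (2 * i + 1 : ℤ) - 1) * (x ^ (2 * i + 1 : ℤ) - 1)) (fun k => b (k + 1) ^ 2)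
    (fun _ _ => rfl) (fun _ _ => rfl)
    (fun i _ => by
      simp only [ne_eq, hone, ← zpow_neg, neg_neg]
      rw [if_pos (by omega), if_pos (by omega)]
      exact (monomialEquiv_one_sub_neg hx _).mul hx (monomialEquiv_one_sub _))
    (fun k => by
      simp only [ne_eq, hone, ← zpow_neg, neg_neg, hb, pow_two]
      rw [if_pos (by omega), if_pos (by omega)]
      push_cast
      exact (monomialEquiv_one_sub_neg hx _).mul hx (monomialEquiv_one_sub _))
  have h2 := prod_BRoots_monomialEquiv hx hr
    (F := fun α => if evalRoot α r ≠ -1 then 1 + (evalRoot α r)⁻¹ else 1)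
    (fun z => if z ≠ -1 then 1 + z⁻¹ else 1) (fun z => if z ≠ -1 then 1 + z⁻¹ else 1)
    (fun i => (x ^ (2 * i + 1 : ℤ) + 1) * (x ^ (2 * i + 1 : ℤ) + 1))
    (fun k => (x ^ (2 * (k + 1) : ℤ) + 1) * (x ^ (2 * (k + 1) : ℤ) + 1))
    (fun _ _ => rfl) (fun _ _ => rfl)
    (fun i _ => by
      simp only [if_pos (hnegone _), ← zpow_neg, neg_neg]
      exact (monomialEquiv_one_add_neg hx _).mul hx (monomialEquiv_one_add _))
    (fun k => by
      simp only [if_pos (hnegone _), ← zpow_neg, neg_neg]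
      exact (monomialEquiv_one_add_neg hx _).mul hx (monomialEquiv_one_add _))
  have h3 := prod_BRoots_monomialEquiv hx hr
    (F := fun α => if evalRoot α r ≠ -(if α ∈ Bshort (n + 1) then x ^ (-(2 * a + 1)) else 1) then
      1 + (if α ∈ Bshort (n + 1) then x ^ (-(2 * a + 1)) else 1) * (evalRoot α r)⁻¹ else 1)
    (fun z => if z ≠ -x ^ (-(2 * a + 1)) then 1 + x ^ (-(2 * a + 1)) * z⁻¹ else 1)
    (fun z => if z ≠ -1 then 1 + z⁻¹ else 1)
    (fun i => ((x ^ 2) ^ (a + i + 1) + 1) * ((x ^ 2) ^ (a - i) + 1))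
    (fun k => (x ^ (2 * (k + 1) : ℤ) + 1) * (x ^ (2 * (k + 1) : ℤ) + 1))
    (fun α h => by simp only [if_pos h])
    (fun α h => by simp only [if_neg (hnot α h), one_mul])
    (fun i _ => by
      simp only [if_pos (hneg _ _), ← zpow_neg, ← zpow_add₀ hx, ← zpow_natCast x 2, ← zpow_mul]
      convert (monomialEquiv_one_add_neg hx (2 * (a + i + 1))).mul hx
        (monomialEquiv_one_add_neg hx (2 * (a - i))) using 5 <;> ring)
    (fun k => by
      simp only [if_pos (hnegone _), ← zpow_neg, neg_neg]
      exact (monomialEquiv_one_add_neg hx _).mul hx (monomialEquiv_one_add _))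
  have h4 := prod_BRoots_monomialEquiv hx hr
    (F := fun α => if evalRoot α r ≠ (if α ∈ Bshort (n + 1)
        then x ^ (-(2 * ((n + 1 : ℕ) : ℤ) - 1)) else x ^ (-2 : ℤ)) then
      1 - (if α ∈ Bshort (n + 1) then x ^ (-(2 * ((n + 1 : ℕ) : ℤ) - 1)) else x ^ (-2 : ℤ)) *
        (evalRoot α r)⁻¹ else 1)
    (fun z => if z ≠ x ^ (-(2 * ((n + 1 : ℕ) : ℤ) - 1)) then
      1 - x ^ (-(2 * ((n + 1 : ℕ) : ℤ) - 1)) * z⁻¹ else 1)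
    (fun z => if z ≠ x ^ (-2 : ℤ) then 1 - x ^ (-2 : ℤ) * z⁻¹ else 1)
    (fun i => b (n + 1 + i) * (if i = n then 1 else b (n - i)))
    (fun k => b (k + 2) * (if k = 0 then 1 else b k))
    (fun α h => by simp only [if_pos h])
    (fun α h => by simp only [if_neg (hnot α h)])
    (fun i hi => by
      simp only [ne_eq, hinj, ← zpow_neg, ← zpow_add₀ hx]
      rw [if_pos (by omega)]
      refine .mul hx ?_ ?_
      · convert monomialEquiv_one_sub_neg hx (2 * (n + 1 + i : ℕ)) using 3
        push_cast
        ring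
      · by_cases h : i = n
        · rw [if_pos h, if_neg (by omega)]
          exact .refl _ _
        · rw [if_neg h, if_pos (by omega)]
          convert monomialEquiv_one_sub_neg hx (2 * (n - i : ℕ)) using 3
          omega)
    (fun k => by
      simp only [ne_eq, hinj, ← zpow_neg, ← zpow_add₀ hx]
      rw [if_pos (by omega)]
      refine .mul hx ?_ ?_
      · convert monomialEquiv_one_sub_neg hx (2 * (k + 2 : ℕ)) using 3
        push_cast
        ring
      · by_cases h : k = 0
        · rw [if_pos h, if_neg (by omega)]
          exact .refl _ _
        · rw [if_neg h, if_pos (by omega)]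
          convert monomialEquiv_one_sub (x := x) (2 * k) using 3
          ring)
  convert (h1.mul hx h2).div hx (h3.mul hx h4) using 1
  rw [prod_Icc_eq_prod_range, prod_range_short]
  have key := prod_residue_identity b n
  have hsq : ∏ i ∈ range (n + 1), b (2 * i + 1) ^ 2 =
      (∏ i ∈ range (n + 1), (x ^ (2 * i + 1 : ℤ) - 1) * (x ^ (2 * i + 1 : ℤ) - 1)) *
        ∏ i ∈ range (n + 1), (x ^ (2 * i + 1 : ℤ) + 1) * (x ^ (2 * i + 1 : ℤ) + 1) := by
    rw [← prod_mul_distrib]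
    refine prod_congr rfl fun i _ => ?_
    have : b (2 * i + 1) = x ^ (2 * i + 1 : ℤ) * x ^ (2 * i + 1 : ℤ) - 1 := by
      rw [← zpow_add₀ hx, hb]
      push_cast
      ring_nf
    rw [this]
    ring
  have hb1 : b 1 = x ^ 2 - 1 := by simp only [hb]; norm_cast
  rw [hsq, hb1] at key
  have hE : ∏ i ∈ range (n + 1), ∏ k ∈ range (2 * i),
      (x ^ (2 * (k + 1) : ℤ) + 1) * (x ^ (2 * (k + 1) : ℤ) + 1) ≠ 0 :=
    prod_ne_zero_iff.2 fun i _ => prod_ne_zero_iff.2 fun k _ => mul_ne_zero (hadd _) (hadd _)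
  have hS : ∏ k ∈ range (2 * n + 1), b (k + 1) ≠ 0 := prod_ne_zero_iff.2 fun k _ => hb0 k
  have hL : ∏ i ∈ range (n + 1), ∏ k ∈ range (2 * i), b (k + 2) * (if k = 0 then 1 else b k) ≠ 0 :=
    prod_ne_zero_iff.2 fun i _ => prod_ne_zero_iff.2 fun k _ => mul_ne_zero (hb0 _) (by
      cases k with
      | zero => simp
      | succ k => simpa using hb0 k)
  have hQ : ∏ i ∈ range (n + 1), ((x ^ 2) ^ (a + i + 1) + 1) * ((x ^ 2) ^ (a - i) + 1) ≠ 0 := by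
    simp only [← zpow_natCast x 2, ← zpow_mul]
    exact prod_ne_zero_iff.2 fun i _ => mul_ne_zero (hadd _) (hadd _)
  rw [div_eq_div_iff hQ (by simp only [mul_ne_zero_iff]; tauto)]
  generalize (∏ i ∈ range (n + 1), ((x ^ 2) ^ (a + i + 1) + 1) * ((x ^ 2) ^ (a - i) + 1)) = Q
  generalize (∏ i ∈ range (n + 1), ∏ k ∈ range (2 * i),
    (x ^ (2 * (k + 1) : ℤ) + 1) * (x ^ (2 * (k + 1) : ℤ) + 1)) = E
  linear_combination (-Q * E) * key

/-- with `m₋ = a + 1/2`, `m₊ = N + 1/2`, `m₊ ≥ m₋ > 0`, `m₊ > 1/2` and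
`r_i = v^{2i-1}`, there are a sign `ε₀` and an integer `k` such that
`Res(r) = ε₀ · v^k · (q-1)^N / ∏_{j=m₋-m₊+1}^{m₋+m₊-1} (q^j + 1)`, where `q = v²` and the
product runs over the `2N` consecutive integers `j` with `a - N + 1 ≤ j ≤ a + N`. -/
theorem statement1 (v : ℝ) (hv : 1 < v) (N : ℕ) (hN : 1 ≤ N)
    (mminus mplus : ℚ) (a : ℤ) (hmm : mminus = a + 1 / 2) (hmp : mplus = N + 1 / 2)
    (h0 : 0 < mminus) (hle : mminus ≤ mplus)
    (r : Fin N → ℂ) (hr : ∀ i, r i = (v : ℂ) ^ (2 * (i : ℕ) + 1)) :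
    ∃ ε₀ : ℂ, (ε₀ = 1 ∨ ε₀ = -1) ∧ ∃ k : ℤ,
      ResMu (fun α => if α ∈ Bshort N then (v : ℂ) ^ (-(2 * a + 1)) else 1)
          (fun α => if α ∈ Bshort N then (v : ℂ) ^ (-(2 * (N : ℤ) - 1)) else (v : ℂ) ^ (-2 : ℤ))
          r
        = ε₀ * (v : ℂ) ^ k * ((v : ℂ) ^ 2 - 1) ^ N /
            ∏ j ∈ Finset.Icc (a - N + 1) (a + N), (((v : ℂ) ^ 2) ^ j + 1) := by
  obtain ⟨n, rfl⟩ : ∃ n, N = n + 1 := ⟨N - 1, by omega⟩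
  obtain ⟨ε, hε, k, h⟩ := ResMu_monomialEquiv hv n a hr
  exact ⟨ε, hε, k, by rw [h, mul_div_assoc]⟩
end
end

section
/- Let m₋, m₊ ∈ ℤ + 1/2 with m₊ > 1/2 and set N = m₊ − 1/2 ∈ ℤ≥1. Then the following exact identity of rational functions in ℚ(v, t) holds: (1 − t²)² / ((1 + v^{2m₋} t)(1 + v^{−2m₋} t)(1 − v^{2(m₊−1)} t)(1 − v^{−2(m₊−1)} t)) × ∏_{j=1}^{N} (1 − t v^{2j−1})² (1 − t v^{−(2j−1)})² / ((1 − t v^{2j+1})(1 − t v^{2j−3})(1 − t v^{−(2j+1)})(1 − t v^{−(2j−3)})) = (1 − t²)² / ((1 + v^{2m₋} t)(1 + v^{−2m₋} t)(1 − v^{2m₊} t)(1 − v^{−2m₊} t)). (This shows that the factors of the pulled-back μ-function along the spectral transfer morphism φ_{T,m₋,m₊} involving the free coordinate t reproduce exactly the short-root μ-factor with parameters (m₋, m₊) in place of (m₋, m₊ − 1), establishing condition (T3) for the non-constant part.) -/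
/-!
STATEMENT 2. The exact identity of rational functions in `ℚ(v,t)` expressing that the
non-constant factors of the pulled-back μ-function along `φ_{T,m₋,m₊}` reproduce the
short-root μ-factor with parameters `(m₋, m₊)` in place of `(m₋, m₊-1)`.
Here `m₋ = a + 1/2`, `m₊ = N + 1/2` with `N ≥ 1`.
-/

noncomputable section

/-- The field `ℚ(v, t, …)` of rational functions. -/
abbrev RF2 : Type := FractionRing (MvPolynomial ℕ ℚ)

/-- The indeterminate `v`. -/
def Vrf : RF2 := algebraMap (MvPolynomial ℕ ℚ) RF2 (MvPolynomial.X 0)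

/-- The indeterminate `t`. -/
def Trf : RF2 := algebraMap (MvPolynomial ℕ ℚ) RF2 (MvPolynomial.X 1)

theorem Vrf_ne_zero : Vrf ≠ 0 := by
  simp [Vrf]

theorem Trf_ne_Vrf_pow (n : ℕ) : Trf ≠ Vrf ^ n := by
  intro h
  rw [Trf, Vrf, ← map_pow] at h
  have h' := IsFractionRing.injective (MvPolynomial ℕ ℚ) RF2 h
  simpa using congrArg (MvPolynomial.eval fun i : ℕ => if i = 0 then (1 : ℚ) else 0) h'

theorem Trf_mul_Vrf_pow_ne_one (n : ℕ) : Trf * Vrf ^ n ≠ 1 := by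
  intro h
  rw [Trf, Vrf, ← map_pow, ← map_mul, ← map_one (algebraMap (MvPolynomial ℕ ℚ) RF2)] at h
  have h' := IsFractionRing.injective (MvPolynomial ℕ ℚ) RF2 h
  simpa using congrArg (MvPolynomial.eval fun i : ℕ => if i = 0 then (1 : ℚ) else 0) h'

theorem one_sub_Trf_mul_Vrf_zpow_ne_zero (k : ℤ) : 1 - Trf * Vrf ^ k ≠ 0 := by
  rw [sub_ne_zero]
  obtain ⟨n, rfl | rfl⟩ := k.eq_nat_or_neg
  · rw [zpow_natCast]
    exact (Trf_mul_Vrf_pow_ne_one n).symm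
  · intro h
    rw [zpow_neg, zpow_natCast, ← div_eq_mul_inv,
      eq_div_iff (pow_ne_zero n Vrf_ne_zero), one_mul] at h
    exact Trf_ne_Vrf_pow n h.symm

/-- The product of the ratios `h j ^ 2 / (h (j + 1) * h (j - 1))` telescopes. -/
theorem prod_sq_div_telescope {K : Type*} [Field K] (h : ℤ → K) (h_ne : ∀ j, h j ≠ 0)
    (h_symm : h 0 = h 1) (N : ℕ) :
    ∏ j ∈ Finset.Icc 1 N, h j ^ 2 / (h (j + 1) * h (j - 1)) = h N / h (N + 1) := by
  induction N with
  | zero => simp [h_symm, h_ne]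
  | succ n ih =>
    rw [Finset.prod_Icc_succ_top (by omega), ih]
    push_cast
    rw [add_sub_cancel_right]
    have h₀ := h_ne n
    have h₁ := h_ne (n + 1)
    have h₂ := h_ne (n + 1 + 1)
    field_simp

theorem statement2 (mminus mplus : ℚ) (a : ℤ) (N : ℕ)
    (hmm : mminus = a + 1 / 2) (hmp : mplus = N + 1 / 2) (hN : 1 ≤ N) :
    (1 - Trf ^ 2) ^ 2 /
        ((1 + Vrf ^ (2 * a + 1) * Trf) * (1 + Vrf ^ (-(2 * a + 1)) * Trf) *
          (1 - Vrf ^ (2 * (N : ℤ) - 1) * Trf) * (1 - Vrf ^ (-(2 * (N : ℤ) - 1)) * Trf)) *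
      ∏ j ∈ Finset.Icc 1 N,
        ((1 - Trf * Vrf ^ (2 * (j : ℤ) - 1)) ^ 2 * (1 - Trf * Vrf ^ (-(2 * (j : ℤ) - 1))) ^ 2 /
          ((1 - Trf * Vrf ^ (2 * (j : ℤ) + 1)) * (1 - Trf * Vrf ^ (2 * (j : ℤ) - 3)) *
            (1 - Trf * Vrf ^ (-(2 * (j : ℤ) + 1))) * (1 - Trf * Vrf ^ (-(2 * (j : ℤ) - 3))))) =
      (1 - Trf ^ 2) ^ 2 /
        ((1 + Vrf ^ (2 * a + 1) * Trf) * (1 + Vrf ^ (-(2 * a + 1)) * Trf) *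
          (1 - Vrf ^ (2 * (N : ℤ) + 1) * Trf) * (1 - Vrf ^ (-(2 * (N : ℤ) + 1)) * Trf)) := by
  let h : ℤ → RF2 := fun j => (1 - Trf * Vrf ^ (2 * j - 1)) * (1 - Trf * Vrf ^ (-(2 * j - 1)))
  have h_ne (j : ℤ) : h j ≠ 0 :=
    mul_ne_zero (one_sub_Trf_mul_Vrf_zpow_ne_zero _) (one_sub_Trf_mul_Vrf_zpow_ne_zero _)
  have h_succ (j : ℤ) :
      h (j + 1) = (1 - Trf * Vrf ^ (2 * j + 1)) * (1 - Trf * Vrf ^ (-(2 * j + 1))) := by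
    simp only [h, show 2 * (j + 1) - 1 = 2 * j + 1 by ring]
  have h_pred (j : ℤ) :
      h (j - 1) = (1 - Trf * Vrf ^ (2 * j - 3)) * (1 - Trf * Vrf ^ (-(2 * j - 3))) := by
    simp only [h, show 2 * (j - 1) - 1 = 2 * j - 3 by ring]
  have h_symm : h 0 = h 1 := by
    norm_num [h, mul_comm]
  have h_prod := prod_sq_div_telescope h h_ne h_symm N
  rw [Finset.prod_congr rfl fun j _ => ?_, h_prod]
  · set A := (1 + Vrf ^ (2 * a + 1) * Trf) * (1 + Vrf ^ (-(2 * a + 1)) * Trf)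
    rw [mul_assoc A, mul_assoc A, mul_comm _ Trf, mul_comm _ Trf, mul_comm _ Trf,
      mul_comm _ Trf, ← h_succ]
    change _ / (A * h N) * _ = _
    rw [div_mul_div_comm, mul_right_comm A, mul_div_mul_right _ _ (h_ne N)]
  · rw [h_succ, h_pred]
    congr 1
    · simp only [h]
      ring
    · ring
end
end

section
/- Let m₋, m₊ ∈ ℤ with m₊ ≥ m₋ ≥ 0 and m₊ ≥ 3. On the root system R₀ of type B_{2(m₊−1)} assign the parameters (m₋(α), m₊(α)) = (m₋, m₊ − 2) to the short roots ±e_i and (0, 1) to the long roots ±e_i ± e_j. Then the point r = (1, q, q, q², q², …, q^{m₊−2}, q^{m₊−2}, q^{m₊−1}) is a residual point; more precisely, exactly 4(m₊ − 1) roots α ∈ R₀ satisfy α(r) = q^{−m₊(α)} (namely 4(m₊ − 2) long roots of the form e_i − e_j, the two long roots −(e₁ + e₂) and −(e₁ + e₃), and the two short roots −e_i at the coordinates equal to q^{m₊−2}), exactly 2(m₊ − 1) roots satisfy α(r) = 1, and no root satisfies α(r) = −q^{−m₋(α)} or α(r) = −1; hence the defect equals 2(m₊ − 1), the rank. (This verifies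 that the image of the spectral transfer morphism ψ_{T,m₋,m₊} is a residual coset.) -/
/-!
STATEMENT 3. The image of the spectral transfer morphism `ψ_{T,m₋,m₊}` is a residual coset:
for integers `m₊ ≥ m₋ ≥ 0` with `m₊ ≥ 3`, the point
`r = (1, q, q, q², q², …, q^{m₊-2}, q^{m₊-2}, q^{m₊-1})` is a residual point for the type
`B_{2(m₊-1)}` root system with parameters `(m₋, m₊-2)` on short roots, `(0,1)` on long roots.
-/

open Finset
open scoped Classical

noncomputable section

/-- The short root `e_i` or `-e_i`, the sign being recorded by a Boolean. -/
def shortRoot {n : ℕ} (p : Fin n × Bool) : Fin n → ℤ :=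
  Pi.single p.1 (if p.2 then (1 : ℤ) else -1)

/-- The vector `±e_i ± e_j`, the signs being recorded by Booleans. -/
def longRoot {n : ℕ} (p : (Fin n × Fin n) × Bool × Bool) : Fin n → ℤ :=
  Pi.single p.1.1 (if p.2.1 then (1 : ℤ) else -1) +
    Pi.single p.1.2 (if p.2.2 then (1 : ℤ) else -1)

theorem bool_sign_ne_zero (b : Bool) : (if b then (1 : ℤ) else -1) ≠ 0 := by
  cases b <;> simp

theorem bool_sign_injective : Function.Injective fun b : Bool => if b then (1 : ℤ) else -1 := by
  intro a b
  cases a <;> cases b <;> simp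

theorem shortRoot_apply_ne_zero {n : ℕ} (p : Fin n × Bool) (k : Fin n) :
    shortRoot p k ≠ 0 ↔ k = p.1 := by
  have := bool_sign_ne_zero p.2
  simp only [shortRoot, Pi.single_apply]
  split_ifs <;> simp_all

theorem longRoot_apply_ne_zero {n : ℕ} {p : (Fin n × Fin n) × Bool × Bool}
    (hp : p.1.1 ≠ p.1.2) (k : Fin n) :
    longRoot p k ≠ 0 ↔ k = p.1.1 ∨ k = p.1.2 := by
  have h1 := bool_sign_ne_zero p.2.1
  have h2 := bool_sign_ne_zero p.2.2
  simp only [longRoot, Pi.add_apply, Pi.single_apply]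
  by_cases h : k = p.1.1
  · subst h
    simp [hp, h1]
  · by_cases h' : k = p.1.2
    · simp [h', hp.symm, h2]
    · simp [h, h']

theorem shortRoot_injective {n : ℕ} : Function.Injective (shortRoot (n := n)) := by
  rintro ⟨i, s⟩ ⟨j, t⟩ h
  have hij : i = j := (shortRoot_apply_ne_zero (j, t) i).1
    (h ▸ (shortRoot_apply_ne_zero (i, s) i).2 rfl)
  subst hij
  have := congrFun h i
  simp only [shortRoot, Pi.single_eq_same] at this
  rw [bool_sign_injective this]

theorem longRoot_injOn {n : ℕ} :
    Set.InjOn longRoot {p : (Fin n × Fin n) × Bool × Bool | p.1.1 < p.1.2} := by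
  rintro ⟨⟨i, j⟩, s, t⟩ hp ⟨⟨i', j'⟩, s', t'⟩ hp' h
  simp only [Set.mem_ofPred_eq] at hp hp'
  have key : ∀ k, (k = i ∨ k = j) ↔ (k = i' ∨ k = j') := fun k => by
    have h1 := longRoot_apply_ne_zero (p := ((i, j), s, t)) hp.ne k
    have h2 := longRoot_apply_ne_zero (p := ((i', j'), s', t')) hp'.ne k
    rw [h] at h1
    exact h1.symm.trans h2
  have hi := (key i).1 (Or.inl rfl)
  have hj := (key j).1 (Or.inr rfl)
  obtain ⟨rfl, rfl⟩ : i = i' ∧ j = j' := by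
    simp only [Fin.ext_iff, Fin.lt_def] at *
    omega
  have h1 := congrFun h i
  have h2 := congrFun h j
  simp only [longRoot, Pi.add_apply, Pi.single_eq_same, Pi.single_eq_of_ne hp.ne,
    Pi.single_eq_of_ne hp.ne', add_zero, zero_add] at h1 h2
  rw [bool_sign_injective h1, bool_sign_injective h2]

theorem Bshort_eq_image (n : ℕ) : Bshort n = Finset.univ.image shortRoot := rfl

theorem Blong_eq_image (n : ℕ) :
    Blong n = (Finset.univ.filter
      fun p : (Fin n × Fin n) × Bool × Bool => p.1.1 < p.1.2).image longRoot := by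
  ext α
  simp only [Blong, Finset.mem_image, Finset.mem_filter, Finset.mem_univ, true_and]
  constructor
  · rintro ⟨⟨⟨i, j⟩, s, t⟩, hp, rfl⟩
    rcases lt_or_gt_of_ne hp with h | h
    · exact ⟨((i, j), s, t), h, rfl⟩
    · exact ⟨((j, i), t, s), h, add_comm _ _⟩
  · rintro ⟨p, hp, rfl⟩
    exact ⟨p, hp.ne, rfl⟩

theorem shortRoot_mem_Bshort {n : ℕ} (p : Fin n × Bool) : shortRoot p ∈ Bshort n :=
  Finset.mem_image_of_mem _ (Finset.mem_univ p)

theorem longRoot_notMem_Bshort {n : ℕ} {p : (Fin n × Fin n) × Bool × Bool}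
    (hp : p.1.1 < p.1.2) : longRoot p ∉ Bshort n := by
  rw [Bshort_eq_image, Finset.mem_image]
  rintro ⟨p', -, h⟩
  have h1 := (longRoot_apply_ne_zero hp.ne p.1.1).2 (Or.inl rfl)
  have h2 := (longRoot_apply_ne_zero hp.ne p.1.2).2 (Or.inr rfl)
  rw [← h, shortRoot_apply_ne_zero] at h1 h2
  exact hp.ne (h1.trans h2.symm)

/-- Counting roots of `B_n` amounts to counting signed indices and signed increasing pairs of
indices. -/
theorem card_filter_BRoots {n : ℕ} (P : (Fin n → ℤ) → Prop) [DecidablePred P] :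
    ((BRoots n).filter P).card =
      (Finset.univ.filter fun p : Fin n × Bool => P (shortRoot p)).card +
      (Finset.univ.filter fun p : (Fin n × Fin n) × Bool × Bool =>
        p.1.1 < p.1.2 ∧ P (longRoot p)).card := by
  have hdisj : Disjoint (Bshort n) (Blong n) := by
    rw [Finset.disjoint_right, Blong_eq_image]
    intro α hα
    obtain ⟨p, hp, rfl⟩ := Finset.mem_image.1 hα
    exact longRoot_notMem_Bshort (Finset.mem_filter.1 hp).2
  rw [BRoots, Finset.filter_union,
    Finset.card_union_of_disjoint (Finset.disjoint_filter_filter hdisj), Bshort_eq_image,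
    Blong_eq_image, Finset.filter_image, Finset.filter_image,
    Finset.card_image_of_injective _ shortRoot_injective, Finset.card_image_of_injOn,
    Finset.filter_filter]
  refine longRoot_injOn.mono fun p hp => ?_
  simp only [Finset.coe_filter, Finset.mem_filter, Finset.mem_univ, true_and,
    Set.mem_ofPred_eq] at hp ⊢
  exact hp.1

theorem evalRoot_eq_zpow_sum {n : ℕ} (α : Fin n → ℤ) {q : ℂ} (hq : q ≠ 0) (c : Fin n → ℕ)
    (r : Fin n → ℂ) (hr : ∀ i, r i = q ^ c i) : evalRoot α r = q ^ (∑ i, α i * (c i : ℤ)) := by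
  have hsum : ∀ s : Finset (Fin n), q ^ (∑ i ∈ s, α i * (c i : ℤ)) = ∏ i ∈ s, r i ^ α i := by
    intro s
    induction s using Finset.induction_on with
    | empty => simp
    | insert a s ha ih =>
      rw [Finset.sum_insert ha, Finset.prod_insert ha, zpow_add₀ hq, ih, hr, mul_comm (α a),
        zpow_mul, zpow_natCast]
  rw [hsum, evalRoot]

theorem sum_shortRoot_mul {n : ℕ} (p : Fin n × Bool) (c : Fin n → ℤ) :
    ∑ i, shortRoot p i * c i = (if p.2 then (1 : ℤ) else -1) * c p.1 := by
  simp [shortRoot, Pi.single_apply]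

theorem sum_longRoot_mul {n : ℕ} (p : (Fin n × Fin n) × Bool × Bool) (c : Fin n → ℤ) :
    ∑ i, longRoot p i * c i =
      (if p.2.1 then (1 : ℤ) else -1) * c p.1.1 + (if p.2.2 then (1 : ℤ) else -1) * c p.1.2 := by
  simp [longRoot, Pi.single_apply, add_mul, Finset.sum_add_distrib]

theorem ofReal_sq_zpow_inj {v : ℝ} (hv : 1 < v) (a b : ℤ) :
    ((v : ℂ) ^ 2) ^ a = ((v : ℂ) ^ 2) ^ b ↔ a = b := by
  have h : (1 : ℝ) < v ^ 2 := one_lt_pow₀ hv two_ne_zero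
  rw [← zpow_right_inj₀ (zero_lt_one.trans h) h.ne' (m := a) (n := b)]
  norm_cast

theorem ofReal_sq_zpow_ne_neg {v : ℝ} (hv : 1 < v) (a b : ℤ) :
    ((v : ℂ) ^ 2) ^ a ≠ -((v : ℂ) ^ 2) ^ b := by
  have h : 0 < v ^ 2 := by positivity
  intro hab
  have h' : (v ^ 2) ^ a = -(v ^ 2) ^ b := by exact_mod_cast hab
  linarith [zpow_pos h a, zpow_pos h b]

/-- The short roots on which the exponent of `q` is `-(k - 1)` are `-e_i` for the two coordinates
of exponent `k - 1`. -/
theorem card_short_exponent_eq_neg {k : ℕ} (hk : 2 ≤ k) :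
    (Finset.univ.filter fun p : Fin (2 * k) × Bool =>
      (if p.2 then (1 : ℤ) else -1) * ((((p.1 : ℕ) + 1) / 2 : ℕ) : ℤ) = -((k : ℤ) - 1)).card
      = 2 := by
  have : (Finset.univ.filter fun p : Fin (2 * k) × Bool =>
      (if p.2 then (1 : ℤ) else -1) * ((((p.1 : ℕ) + 1) / 2 : ℕ) : ℤ) = -((k : ℤ) - 1)) =
      {(⟨2 * k - 3, by omega⟩, false), (⟨2 * k - 2, by omega⟩, false)} := by
    ext ⟨i, s⟩
    cases s <;> simp [Fin.ext_iff] <;> omega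
  rw [this, Finset.card_pair]
  simp [Fin.ext_iff]
  omega

theorem card_short_exponent_eq_zero {k : ℕ} (hk : 2 ≤ k) :
    (Finset.univ.filter fun p : Fin (2 * k) × Bool =>
      (if p.2 then (1 : ℤ) else -1) * ((((p.1 : ℕ) + 1) / 2 : ℕ) : ℤ) = 0).card = 2 := by
  have : (Finset.univ.filter fun p : Fin (2 * k) × Bool =>
      (if p.2 then (1 : ℤ) else -1) * ((((p.1 : ℕ) + 1) / 2 : ℕ) : ℤ) = 0) =
      {(⟨0, by omega⟩, false), (⟨0, by omega⟩, true)} := by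
    ext ⟨i, s⟩
    cases s <;> simp [Fin.ext_iff] <;> omega
  rw [this, Finset.card_pair]
  simp

theorem card_long_exponent_eq_neg_one {k : ℕ} (hk : 2 ≤ k) :
    (Finset.univ.filter fun p : (Fin (2 * k) × Fin (2 * k)) × Bool × Bool => p.1.1 < p.1.2 ∧
      (if p.2.1 then (1 : ℤ) else -1) * ((((p.1.1 : ℕ) + 1) / 2 : ℕ) : ℤ) +
        (if p.2.2 then (1 : ℤ) else -1) * ((((p.1.2 : ℕ) + 1) / 2 : ℕ) : ℤ) = -1).card
      = 4 * k - 2 := by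
  rw [Finset.card_eq_sum_card_fiberwise (f := fun p => p.1.2) (t := Finset.univ)
    (fun _ _ => Finset.mem_coe.2 (Finset.mem_univ _))]
  have hfib : ∀ j : Fin (2 * k), (Finset.filter (fun p => p.1.2 = j)
      (Finset.univ.filter fun p : (Fin (2 * k) × Fin (2 * k)) × Bool × Bool => p.1.1 < p.1.2 ∧
      (if p.2.1 then (1 : ℤ) else -1) * ((((p.1.1 : ℕ) + 1) / 2 : ℕ) : ℤ) +
        (if p.2.2 then (1 : ℤ) else -1) * ((((p.1.2 : ℕ) + 1) / 2 : ℕ) : ℤ) = -1)).card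
      = if (j : ℕ) = 0 then 0 else 2 := by
    intro j
    obtain ⟨j, hj⟩ := j
    split_ifs with h0
    · rw [Finset.card_eq_zero, Finset.filter_filter, Finset.filter_eq_empty_iff]
      rintro ⟨⟨i, j'⟩, s, t⟩ -
      simp only [Fin.ext_iff, Fin.lt_def] at h0 ⊢
      omega
    · rw [Finset.card_eq_two]
      by_cases h2 : j ≤ 2
      · refine ⟨((⟨0, by omega⟩, ⟨j, hj⟩), true, false), ((⟨0, by omega⟩, ⟨j, hj⟩), false, false),
          by simp, ?_⟩
        ext ⟨⟨i, j'⟩, s, t⟩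
        cases s <;> cases t <;> simp [Fin.ext_iff] at h0 ⊢ <;> omega
      · refine ⟨((⟨2 * ((j + 1) / 2) - 2, by omega⟩, ⟨j, hj⟩), true, false),
          ((⟨2 * ((j + 1) / 2) - 3, by omega⟩, ⟨j, hj⟩), true, false),
          by simp [Fin.ext_iff]; omega, ?_⟩
        ext ⟨⟨i, j'⟩, s, t⟩
        cases s <;> cases t <;> simp [Fin.ext_iff] at h0 ⊢ <;> omega
  rw [Finset.sum_congr rfl fun j _ => hfib j,
    Fin.sum_univ_eq_sum_range (fun j => if j = 0 then 0 else 2) (2 * k)]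
  obtain ⟨m, hm⟩ : ∃ m, 2 * k = m + 1 := ⟨2 * k - 1, by omega⟩
  rw [hm, Finset.sum_range_succ']
  simp
  omega

theorem card_long_exponent_eq_zero {k : ℕ} (hk : 2 ≤ k) :
    (Finset.univ.filter fun p : (Fin (2 * k) × Fin (2 * k)) × Bool × Bool => p.1.1 < p.1.2 ∧
      (if p.2.1 then (1 : ℤ) else -1) * ((((p.1.1 : ℕ) + 1) / 2 : ℕ) : ℤ) +
        (if p.2.2 then (1 : ℤ) else -1) * ((((p.1.2 : ℕ) + 1) / 2 : ℕ) : ℤ) = 0).card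
      = 2 * k - 2 := by
  rw [Finset.card_eq_sum_card_fiberwise (f := fun p => p.1.2) (t := Finset.univ)
    (fun _ _ => Finset.mem_coe.2 (Finset.mem_univ _))]
  have hfib : ∀ j : Fin (2 * k), (Finset.filter (fun p => p.1.2 = j)
      (Finset.univ.filter fun p : (Fin (2 * k) × Fin (2 * k)) × Bool × Bool => p.1.1 < p.1.2 ∧
      (if p.2.1 then (1 : ℤ) else -1) * ((((p.1.1 : ℕ) + 1) / 2 : ℕ) : ℤ) +
        (if p.2.2 then (1 : ℤ) else -1) * ((((p.1.2 : ℕ) + 1) / 2 : ℕ) : ℤ) = 0)).card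
      = if (j : ℕ) ≠ 0 ∧ (j : ℕ) % 2 = 0 then 2 else 0 := by
    intro j
    obtain ⟨j, hj⟩ := j
    split_ifs with h0
    · rw [Finset.card_eq_two]
      refine ⟨((⟨j - 1, by omega⟩, ⟨j, hj⟩), true, false),
        ((⟨j - 1, by omega⟩, ⟨j, hj⟩), false, true), by simp, ?_⟩
      ext ⟨⟨i, j'⟩, s, t⟩
      cases s <;> cases t <;> simp [Fin.ext_iff] at h0 ⊢ <;> omega
    · rw [Finset.card_eq_zero, Finset.filter_filter, Finset.filter_eq_empty_iff]
      rintro ⟨⟨i, j'⟩, s, t⟩ -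
      cases s <;> cases t <;> simp [Fin.ext_iff] at h0 ⊢ <;> omega
  rw [Finset.sum_congr rfl fun j _ => hfib j,
    Fin.sum_univ_eq_sum_range (fun j => if j ≠ 0 ∧ j % 2 = 0 then 2 else 0) (2 * k)]
  clear hfib
  induction k, hk using Nat.le_induction with
  | base => rfl
  | succ m hm ih =>
    rw [show 2 * (m + 1) = 2 * m + 1 + 1 by ring, Finset.sum_range_succ, Finset.sum_range_succ, ih,
      if_pos (by omega), if_neg (by omega)]
    omega

/-- with `q = v²` and `r = (1, q, q, q², q², …, q^{m₊-2}, q^{m₊-2}, q^{m₊-1})`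
(so `r_i = q^{⌊(i+1)/2⌋}` for the 0-indexed coordinate `i` of `Fin (2(m₊-1))`),
exactly `4(m₊-1)` roots take the value `q^{-m₊(α)}` (which is `q^{-(m₊-2)}` on short roots
and `q^{-1}` on long roots), exactly `2(m₊-1)` roots take the value `1`, and no root takes the
value `-q^{-m₋(α)}` nor `-1`; hence the defect equals `2(m₊-1)`, the rank. -/
theorem statement3 (v : ℝ) (hv : 1 < v) (mp mm : ℕ) (h3 : 3 ≤ mp) (hle : mm ≤ mp)
    (r : Fin (2 * (mp - 1)) → ℂ) (hr : ∀ i, r i = ((v : ℂ) ^ 2) ^ (((i : ℕ) + 1) / 2)) :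
    ((BRoots (2 * (mp - 1))).filter fun α => evalRoot α r =
        (if α ∈ Bshort (2 * (mp - 1)) then ((v : ℂ) ^ 2) ^ (-((mp : ℤ) - 2))
          else ((v : ℂ) ^ 2) ^ (-1 : ℤ))).card = 4 * (mp - 1)
    ∧ ((BRoots (2 * (mp - 1))).filter fun α => evalRoot α r = 1).card = 2 * (mp - 1)
    ∧ ((BRoots (2 * (mp - 1))).filter fun α => evalRoot α r =
        -(if α ∈ Bshort (2 * (mp - 1)) then ((v : ℂ) ^ 2) ^ (-(mm : ℤ)) else 1)) = ∅
    ∧ ((BRoots (2 * (mp - 1))).filter fun α => evalRoot α r = -1) = ∅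
    ∧ (((BRoots (2 * (mp - 1))).filter fun α => evalRoot α r =
          (if α ∈ Bshort (2 * (mp - 1)) then ((v : ℂ) ^ 2) ^ (-((mp : ℤ) - 2))
            else ((v : ℂ) ^ 2) ^ (-1 : ℤ))).card : ℤ)
        - ((BRoots (2 * (mp - 1))).filter fun α => evalRoot α r = 1).card
        = 2 * ((mp : ℤ) - 1) := by
  revert r
  generalize hmp : mp - 1 = k
  intro r hr
  obtain rfl : mp = k + 1 := by omega
  have hk : 2 ≤ k := by omega
  have hq : (v : ℂ) ^ 2 ≠ 0 :=
    pow_ne_zero _ (Complex.ofReal_ne_zero.2 (zero_lt_one.trans hv).ne')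
  have heval : ∀ α, evalRoot α r = ((v : ℂ) ^ 2) ^ (∑ i, α i * ((((i : ℕ) + 1) / 2 : ℕ) : ℤ)) :=
    fun α => evalRoot_eq_zpow_sum α hq _ r hr
  have hpos : ((BRoots (2 * k)).filter fun α => evalRoot α r =
      (if α ∈ Bshort (2 * k) then ((v : ℂ) ^ 2) ^ (-(((k + 1 : ℕ) : ℤ) - 2))
        else ((v : ℂ) ^ 2) ^ (-1 : ℤ))).card = 4 * k := by
    rw [card_filter_BRoots]
    trans 2 + (4 * k - 2)
    swap
    · omega
    refine congrArg₂ (· + ·) (Eq.trans (congrArg _ ?_) (card_short_exponent_eq_neg hk))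
      (Eq.trans (congrArg _ ?_) (card_long_exponent_eq_neg_one hk))
    · refine Finset.filter_congr fun p _ => ?_
      rw [if_pos (shortRoot_mem_Bshort p), heval, ofReal_sq_zpow_inj hv, sum_shortRoot_mul]
      push_cast
      rw [show (k : ℤ) + 1 - 2 = k - 1 by ring]
    · refine Finset.filter_congr fun p _ => and_congr_right fun hp => ?_
      rw [if_neg (longRoot_notMem_Bshort hp), heval, ofReal_sq_zpow_inj hv, sum_longRoot_mul]
  have hone : ((BRoots (2 * k)).filter fun α => evalRoot α r = 1).card = 2 * k := by
    have hs := card_short_exponent_eq_zero hk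
    have hl := card_long_exponent_eq_zero hk
    have h1 : ∀ α, evalRoot α r = 1 ↔ ∑ i, α i * ((((i : ℕ) + 1) / 2 : ℕ) : ℤ) = 0 := fun α => by
      rw [heval, ← ofReal_sq_zpow_inj hv, zpow_zero]
    rw [card_filter_BRoots]
    simp only [h1, sum_shortRoot_mul, sum_longRoot_mul]
    rw [hs, hl]
    omega
  refine ⟨hpos, hone, ?_, ?_, ?_⟩
  · refine Finset.filter_eq_empty_iff.2 fun α _ => ?_
    rw [heval]
    split_ifs
    · exact ofReal_sq_zpow_ne_neg hv _ _
    · simpa using ofReal_sq_zpow_ne_neg hv _ 0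
  · refine Finset.filter_eq_empty_iff.2 fun α _ => ?_
    rw [heval]
    simpa using ofReal_sq_zpow_ne_neg hv _ 0
  · rw [hpos, hone]
    push_cast
    ring
end
end

section
/- Let m₊ ∈ ℤ ± 1/4 with m₊ > 1 and let δ₋ ∈ {0, 1}. Define P1 := ∏_{k=δ₊}^{A₊} (1 − q^{2k})² / ((1 + q^{k+δ₋})(1 + q^{k−δ₋})(1 − q^{k+δ₊})(1 − q^{k−δ₊})), where every factor identically equal to 1 − q⁰ = 0 (which occurs only for k = 0 in the numerator and for k = δ₊ in the factor (1 − q^{k−δ₊})) is omitted. Then there exist c ∈ ℚ^× and k₀ ∈ ℤ such that P1 = c · v^{k₀} · ((1 + q^{A₊})/(1 + q^{A₊+1}))^{δ₋} · ((1 − q^{A₊})/(1 − q^{A₊+1}))^{δ₊} · (1 + q)^{(−1)^{1−δ₊} δ₋} · (1 − q)^{δ₊}. (P1 is the regularized type-A factor μ^{A,reg}_{δ₋,δ₊}(σ_e(m₊)).) -/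
/-!
STATEMENT 7. The regularized type-A factor `P1 = μ^{A,reg}_{δ₋,δ₊}(σ_e(m₊))` equals, up to a
nonzero rational constant and a power of `v`,
`((1+q^{A₊})/(1+q^{A₊+1}))^{δ₋} ((1-q^{A₊})/(1-q^{A₊+1}))^{δ₊} (1+q)^{(-1)^{1-δ₊}δ₋} (1-q)^{δ₊}`.
Here `q = v²`, `m₊ = κ₊ + (2ε₊-1)/4 > 1`, `δ₊ ∈ {0,1}` has the parity of `κ₊`,
`A₊ = 2m₊ - 3/2 = 2(κ₊-1) + ε₊`, and the product defining `P1` runs over `k = δ₊, …, A₊`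
with every factor identically equal to `1 - q⁰ = 0` omitted.
-/

noncomputable section

/-- The field `ℚ(v)`; we set `q = v²`. -/
abbrev RF7 : Type := RatFunc ℚ

/-- The indeterminate `v`. -/
def vR : RF7 := RatFunc.X

/-- `q = v²`. -/
def qR : RF7 := RatFunc.X ^ 2

theorem Int.prod_Icc_succ_top {M : Type*} [CommMonoid M] {a b : ℤ} (hab : a ≤ b + 1) (f : ℤ → M) :
    ∏ k ∈ Finset.Icc a (b + 1), f k = (∏ k ∈ Finset.Icc a b, f k) * f (b + 1) := by
  have h : Finset.Icc a (b + 1) = insert (b + 1) (Finset.Icc a b) := by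
    ext x
    simp only [Finset.mem_insert, Finset.mem_Icc]
    omega
  rw [h, Finset.prod_insert (by simp), mul_comm]

/-- A product over an integer interval is determined by its first factor and the successive
quotients. -/
theorem Int.prod_Icc_eq_of_succ {M : Type*} [CommMonoid M] {a b : ℤ} (hab : a ≤ b) (f g : ℤ → M)
    (h0 : f a = g a) (hs : ∀ n, a ≤ n → g n * f (n + 1) = g (n + 1)) :
    ∏ k ∈ Finset.Icc a b, f k = g b := by
  induction b, hab using Int.leInduction with
  | base => simpa using h0
  | succ n hn ih => rw [Int.prod_Icc_succ_top (by omega), ih, hs n hn]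

theorem RatFunc.X_zpow_ne_one {n : ℤ} (hn : n ≠ 0) : (RatFunc.X : RatFunc ℚ) ^ n ≠ 1 := by
  have key : ∀ m : ℕ, m ≠ 0 → (RatFunc.X : RatFunc ℚ) ^ m ≠ 1 := by
    intro m hm h
    rw [← RatFunc.algebraMap_X, ← map_pow, ← map_one (algebraMap (Polynomial ℚ) (RatFunc ℚ))] at h
    have h' := congrArg Polynomial.natDegree (RatFunc.algebraMap_injective ℚ h)
    simp [hm] at h'
  rcases n.eq_nat_or_neg with ⟨m, rfl | rfl⟩
  · rw [zpow_natCast]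
    exact key m (by omega)
  · rw [zpow_neg, zpow_natCast, Ne, inv_eq_one]
    exact key m (by omega)

theorem qR_ne_zero : qR ≠ 0 := pow_ne_zero 2 RatFunc.X_ne_zero

theorem qR_zpow_ne_one {n : ℤ} (hn : n ≠ 0) : qR ^ n ≠ 1 := by
  have h : qR ^ n = RatFunc.X ^ (2 * n) := by rw [qR, zpow_mul]; rfl
  rw [h]
  exact RatFunc.X_zpow_ne_one (by omega)

theorem one_sub_qR_zpow_ne_zero {n : ℤ} (hn : n ≠ 0) : 1 - qR ^ n ≠ 0 :=
  sub_ne_zero.2 (qR_zpow_ne_one hn).symm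

theorem one_add_qR_zpow_ne_zero (n : ℤ) : 1 + qR ^ n ≠ 0 := by
  rcases eq_or_ne n 0 with rfl | hn
  · norm_num
  · intro h
    apply qR_zpow_ne_one (n := 2 * n) (by omega)
    rw [mul_comm, zpow_mul, eq_neg_of_add_eq_zero_right h]
    norm_num

theorem one_sub_qR_zpow_two_mul (n : ℤ) :
    1 - qR ^ (2 * n) = (1 - qR ^ n) * (1 + qR ^ n) := by
  rw [mul_comm, zpow_mul]
  norm_cast
  ring

theorem statement7 (κp εp δp δm : ℕ) (hεp : εp = 0 ∨ εp = 1) (hδp : δp = κp % 2)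
    (hδm : δm = 0 ∨ δm = 1)
    (mplus : ℚ) (hmp : mplus = κp + (2 * (εp : ℚ) - 1) / 4) (h1 : 1 < mplus)
    (A : ℤ) (hA : A = 2 * (κp : ℤ) - 2 + εp) :
    ∃ c : ℚ, c ≠ 0 ∧ ∃ k₀ : ℤ,
      (∏ k ∈ Finset.Icc (δp : ℤ) A,
          ((if k = 0 then 1 else (1 - qR ^ (2 * k)) ^ 2) /
            ((1 + qR ^ (k + δm)) * (1 + qR ^ (k - δm)) *
              (if k + δp = 0 then 1 else 1 - qR ^ (k + δp)) *
              (if k = (δp : ℤ) then 1 else 1 - qR ^ (k - δp))))) =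
        algebraMap ℚ RF7 c * vR ^ k₀ *
          ((1 + qR ^ A) / (1 + qR ^ (A + 1))) ^ δm *
          ((1 - qR ^ A) / (1 - qR ^ (A + 1))) ^ δp *
          (1 + qR) ^ ((-1 : ℤ) ^ (1 - δp) * (δm : ℤ)) * (1 - qR) ^ δp := by
  have hκ : (δp : ℤ) ≤ A ∧ 1 ≤ A := by
    have h2 : (5 : ℚ) < 4 * κp + 2 * εp := by rw [hmp] at h1; linarith
    have h3 : 5 < 4 * κp + 2 * εp := by exact_mod_cast h2
    omega
  obtain ⟨hδA, hA1⟩ := hκ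
  have hq := qR_ne_zero
  have hq1 : 1 + qR ≠ 0 := by simpa using one_add_qR_zpow_ne_zero 1
  have hq2 : 1 - qR ≠ 0 := by simpa using one_sub_qR_zpow_ne_zero (n := 1) one_ne_zero
  have hadd := one_add_qR_zpow_ne_zero
  have hδ : δp = 0 ∨ δp = 1 := by omega
  clear hA hδp h1 hmp hεp
  rcases hδ with rfl | rfl <;> rcases hδm with rfl | rfl
  · refine ⟨1 / 4, by norm_num, 0, ?_⟩
    refine (Int.prod_Icc_eq_of_succ hδA _ (fun _ => algebraMap ℚ RF7 (1 / 4)) ?_ ?_).trans ?_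
    · norm_num
    · intro n hn
      have h1 := one_sub_qR_zpow_ne_zero (n := n + 1) (by omega)
      have h2 := hadd (n + 1)
      have h3 : n + 1 ≠ 0 := by simp at hn; omega
      simp only [Nat.cast_zero, add_zero, sub_zero, h3, if_false, one_sub_qR_zpow_two_mul]
      field_simp
    · simp
  · refine ⟨1 / 2, by norm_num, 2, ?_⟩
    refine (Int.prod_Icc_eq_of_succ hδA _ (fun n => algebraMap ℚ RF7 (1 / 2) * qR *
      ((1 + qR ^ n) / (1 + qR ^ (n + 1))) * (1 + qR)⁻¹) ?_ ?_).trans ?_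
    · have h : 1 + qR⁻¹ = (1 + qR) / qR := by
        field_simp
        ring
      norm_num [h, hq1]
      field_simp
    · intro n hn
      have h1 := one_sub_qR_zpow_ne_zero (n := n + 1) (by omega)
      have h2 := hadd n
      have h3 := hadd (n + 1)
      have h4 := hadd (n + 1 + 1)
      have h5 : n + 1 ≠ 0 := by simp at hn; omega
      simp only [Nat.cast_zero, Nat.cast_one, add_zero, sub_zero, h5, if_false,
        one_sub_qR_zpow_two_mul, add_sub_cancel_right]
      field_simp
    · simp [vR, qR]
  · refine ⟨1, by norm_num, 0, ?_⟩
    refine (Int.prod_Icc_eq_of_succ hδA _ (fun n =>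
      ((1 - qR ^ n) / (1 - qR ^ (n + 1))) * (1 - qR)) ?_ ?_).trans ?_
    · have h1 := one_sub_qR_zpow_ne_zero (n := 1 + 1) (by omega)
      have h2 := one_sub_qR_zpow_two_mul 1
      norm_num at *
      rw [h2] at *
      field_simp
    · intro n hn
      simp at hn
      have h1 := one_sub_qR_zpow_ne_zero (n := n) (by omega)
      have h2 := one_sub_qR_zpow_ne_zero (n := n + 1) (by omega)
      have h3 := one_sub_qR_zpow_ne_zero (n := n + 1 + 1) (by omega)
      have h4 := hadd (n + 1)
      have h5 : n + 1 ≠ 0 := by omega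
      have h6 : n + 1 + 1 ≠ 0 := by omega
      have h7 : n + 1 ≠ 1 := by omega
      simp only [Nat.cast_zero, Nat.cast_one, add_zero, sub_zero, h5, h6, h7, if_false,
        one_sub_qR_zpow_two_mul, add_sub_cancel_right]
      field_simp
    · simp
  · refine ⟨1 / 2, by norm_num, 0, ?_⟩
    refine (Int.prod_Icc_eq_of_succ hδA _ (fun n => algebraMap ℚ RF7 (1 / 2) *
      ((1 + qR ^ n) / (1 + qR ^ (n + 1))) *
      ((1 - qR ^ n) / (1 - qR ^ (n + 1))) * (1 + qR) * (1 - qR)) ?_ ?_).trans ?_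
    · have h1 := one_sub_qR_zpow_ne_zero (n := 1 + 1) (by omega)
      have h2 := one_sub_qR_zpow_two_mul 1
      have h3 := hadd (1 + 1)
      norm_num at *
      rw [h2] at *
      field_simp
    · intro n hn
      simp at hn
      have h1 := one_sub_qR_zpow_ne_zero (n := n) (by omega)
      have h2 := one_sub_qR_zpow_ne_zero (n := n + 1) (by omega)
      have h3 := one_sub_qR_zpow_ne_zero (n := n + 1 + 1) (by omega)
      have h4 := hadd n
      have h8 := hadd (n + 1)
      have h9 := hadd (n + 1 + 1)
      have h5 : n + 1 ≠ 0 := by omega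
      have h6 : n + 1 + 1 ≠ 0 := by omega
      have h7 : n + 1 ≠ 1 := by omega
      simp only [Nat.cast_one, h5, h6, h7, if_false,
        one_sub_qR_zpow_two_mul, add_sub_cancel_right]
      field_simp
    · simp
end
end

section
/- (Table 1, row s = G₂ of the residues of the μ-function of G₂(3,1)[q].) Let r be the point with α₁(r) = q and α₂(r) = q³. Then r is a residual point: exactly the two roots −α₁ and −α₂ satisfy α(r) = q^{−m(α)}, and no root satisfies α(r) = 1. Moreover there exist a sign ε₀ ∈ {1, −1} and an integer k such that Res(r) = ε₀ · q^{k} · Φ₅ Φ₉ / (Φ₂² Φ₃² Φ₆² Φ₁₂). -/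
/-!
STATEMENT 16. Table 1, row `s = G₂`, of the residues of the μ-function of `G₂(3,1)[q]`:
the point `r` with `α₁(r) = q`, `α₂(r) = q³` is a residual point (exactly the two roots
`-α₁`, `-α₂` satisfy `α(r) = q^{-m(α)}` and no root satisfies `α(r) = 1`), and
`Res(r) = ± q^k · Φ₅Φ₉/(Φ₂²Φ₃²Φ₆²Φ₁₂)`.
-/

open scoped Classical

noncomputable section

/-- The field `ℚ(q)` (so `q` is transcendental over `ℚ`). -/
abbrev Kq : Type := RatFunc ℚ

/-- The indeterminate `q`. -/
def qG : Kq := RatFunc.X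

/-- The `n`-th cyclotomic polynomial evaluated at `q`. -/
def Φ (n : ℕ) : Kq := Polynomial.aeval qG (Polynomial.cyclotomic n ℚ)

/-- The roots of the root system of type `G₂`, written in coordinates `(a, b)` for
`α = aα₁ + bα₂` with `α₁` short and `α₂` long. -/
def G2Roots : Finset (ℤ × ℤ) :=
  {(1, 0), (0, 1), (1, 1), (2, 1), (3, 1), (3, 2),
   (-1, 0), (0, -1), (-1, -1), (-2, -1), (-3, -1), (-3, -2)}

/-- The short roots of `G₂`. -/
def G2Short : Finset (ℤ × ℤ) := {(1, 0), (1, 1), (2, 1), (-1, 0), (-1, -1), (-2, -1)}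

/-- The parameters of `G₂(3,1)[q]`: `m(α) = 1` on short roots, `m(α) = 3` on long roots. -/
def mG2 (α : ℤ × ℤ) : ℤ := if α ∈ G2Short then 1 else 3

/-- Evaluation of the root `α = aα₁ + bα₂` at the point `r` with `α₁(r) = x`, `α₂(r) = y`. -/
def evG2 (x y : Kq) (α : ℤ × ℤ) : Kq := x ^ α.1 * y ^ α.2

/-- The normalized regularized residue of the μ-function of `G₂(3,1)[q]` at the point `r`
with `α₁(r) = x`, `α₂(r) = y`; the normalization factor is `d = q²/((q-1)(q³-1))`. -/
def ResG2 (x y : Kq) : Kq :=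
  (qG ^ 2 / ((qG - 1) * (qG ^ 3 - 1))) *
      (∏ α ∈ G2Roots.filter fun α => evG2 x y α ≠ 1, (1 - (evG2 x y α)⁻¹)) /
    ∏ α ∈ G2Roots.filter fun α => evG2 x y α ≠ qG ^ (-mG2 α),
      (1 - qG ^ (-mG2 α) * (evG2 x y α)⁻¹)

lemma qG_ne_zero : qG ≠ 0 := RatFunc.X_ne_zero

lemma qG_pow_injective : Function.Injective fun n : ℕ => qG ^ n := by
  intro m n h
  have h' : (algebraMap (Polynomial ℚ) Kq) (Polynomial.X ^ m) =
      algebraMap (Polynomial ℚ) Kq (Polynomial.X ^ n) := by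
    simpa [qG, RatFunc.algebraMap_X] using h
  simpa using congrArg Polynomial.natDegree (RatFunc.algebraMap_injective ℚ h')

lemma qG_pow_sub_one_ne_zero {n : ℕ} (hn : n ≠ 0) : qG ^ n - 1 ≠ 0 := fun h =>
  hn (qG_pow_injective (by simpa [sub_eq_zero] using h))

lemma qG_zpow_eq_one_iff (n : ℤ) : qG ^ n = 1 ↔ n = 0 := by
  refine ⟨fun h => ?_, fun h => by simp [h]⟩
  have h' : qG ^ n.natAbs = 1 := by
    rw [← zpow_natCast]
    rcases Int.natAbs_eq n with hn | hn <;> rw [hn] at h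
    · exact h
    · rwa [zpow_neg, inv_eq_one] at h
  by_contra hn
  exact qG_pow_sub_one_ne_zero (Int.natAbs_ne_zero.mpr hn) (by rw [h', sub_self])

lemma qG_zpow_inj (m n : ℤ) : qG ^ m = qG ^ n ↔ m = n := by
  rw [← div_eq_one_iff_eq (zpow_ne_zero n qG_ne_zero), ← zpow_sub₀ qG_ne_zero,
    qG_zpow_eq_one_iff, sub_eq_zero]

lemma evG2_qG (α : ℤ × ℤ) : evG2 qG (qG ^ 3) α = qG ^ (α.1 + 3 * α.2) := by
  rw [evG2, zpow_add₀ qG_ne_zero, zpow_mul]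
  norm_cast

lemma prod_Φ_divisors {n : ℕ} (hn : 0 < n) : ∏ d ∈ n.divisors, Φ d = qG ^ n - 1 := by
  simp only [Φ, ← map_prod, Polynomial.prod_cyclotomic_eq_X_pow_sub_one hn]
  simp

lemma Φ_ne_zero {n : ℕ} (hn : 0 < n) : Φ n ≠ 0 := by
  have h := qG_pow_sub_one_ne_zero hn.ne'
  rw [← prod_Φ_divisors hn] at h
  exact Finset.prod_ne_zero_iff.mp h n (Nat.mem_divisors_self n hn.ne')

lemma filter_evG2_eq_one :
    G2Roots.filter (fun α => evG2 qG (qG ^ 3) α = 1) = ∅ := by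
  simp only [evG2_qG, qG_zpow_eq_one_iff]
  simp [G2Roots, Finset.filter_insert, Finset.filter_singleton]

lemma filter_evG2_eq_qG_zpow :
    G2Roots.filter (fun α => evG2 qG (qG ^ 3) α = qG ^ (-mG2 α)) =
      ({(-1, 0), (0, -1)} : Finset (ℤ × ℤ)) := by
  simp only [evG2_qG, qG_zpow_inj]
  simp [G2Roots, Finset.filter_insert, Finset.filter_singleton, mG2, G2Short]

lemma filter_evG2_ne_one :
    G2Roots.filter (fun α => evG2 qG (qG ^ 3) α ≠ 1) = G2Roots :=
  Finset.filter_true_of_mem (Finset.filter_eq_empty_iff.mp filter_evG2_eq_one)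

lemma filter_evG2_ne_qG_zpow :
    G2Roots.filter (fun α => evG2 qG (qG ^ 3) α ≠ qG ^ (-mG2 α)) =
      ({(1, 0), (0, 1), (1, 1), (2, 1), (3, 1), (3, 2),
        (-1, -1), (-2, -1), (-3, -1), (-3, -2)} : Finset (ℤ × ℤ)) := by
  simp only [evG2_qG, ne_eq, qG_zpow_inj]
  simp [G2Roots, Finset.filter_insert, Finset.filter_singleton, mG2, G2Short]

lemma one_sub_qG_zpow_neg (n : ℕ) : 1 - qG ^ (-(n : ℤ)) = (qG ^ n - 1) / qG ^ n := by
  rw [zpow_neg, zpow_natCast, sub_div, div_self (pow_ne_zero n qG_ne_zero), one_div]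

lemma one_sub_qG_zpow (n : ℕ) : 1 - qG ^ (n : ℤ) = -(qG ^ n - 1) := by simp

lemma prod_one_sub_evG2_inv :
    ∏ α ∈ G2Roots, (1 - (evG2 qG (qG ^ 3) α)⁻¹) =
      ((qG ^ 1 - 1) * (qG ^ 3 - 1) * (qG ^ 4 - 1) * (qG ^ 5 - 1) * (qG ^ 6 - 1) *
        (qG ^ 9 - 1)) ^ 2 / qG ^ 28 := by
  simp only [evG2_qG, ← zpow_neg]
  have hprod : ∏ α ∈ G2Roots, (1 - qG ^ (-(α.1 + 3 * α.2))) =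
      ∏ n ∈ ({1, 3, 4, 5, 6, 9} : Finset ℕ), (1 - qG ^ (-(n : ℤ))) * (1 - qG ^ (n : ℤ)) := by
    rw [G2Roots]
    repeat rw [Finset.prod_insert (by decide)]
    simp only [Finset.prod_singleton]
    norm_num only
    ring
  simp only [hprod, one_sub_qG_zpow_neg, one_sub_qG_zpow]
  repeat rw [Finset.prod_insert (by decide)]
  rw [Finset.prod_singleton]
  have := qG_ne_zero
  field_simp

lemma prod_one_sub_qG_zpow_mul_evG2_inv :
    ∏ α ∈ ({(1, 0), (0, 1), (1, 1), (2, 1), (3, 1), (3, 2),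
        (-1, -1), (-2, -1), (-3, -1), (-3, -2)} : Finset (ℤ × ℤ)),
      (1 - qG ^ (-mG2 α) * (evG2 qG (qG ^ 3) α)⁻¹) =
      (qG ^ 2 - 1) * (qG ^ 3 - 1) ^ 2 * (qG ^ 4 - 1) * (qG ^ 5 - 1) * (qG ^ 6 - 1) ^ 3 *
        (qG ^ 9 - 1) * (qG ^ 12 - 1) / qG ^ 40 := by
  simp only [evG2_qG, ← zpow_neg, ← zpow_add₀ qG_ne_zero]
  have hprod : ∏ α ∈ ({(1, 0), (0, 1), (1, 1), (2, 1), (3, 1), (3, 2),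
        (-1, -1), (-2, -1), (-3, -1), (-3, -2)} : Finset (ℤ × ℤ)),
        (1 - qG ^ (-mG2 α + -(α.1 + 3 * α.2))) =
      (∏ n ∈ ({2, 5, 9, 12} : Finset ℕ), (1 - qG ^ (-(n : ℤ)))) *
        (1 - qG ^ (-((6 : ℕ) : ℤ))) ^ 2 *
        ((1 - qG ^ ((3 : ℕ) : ℤ)) ^ 2 * (1 - qG ^ ((4 : ℕ) : ℤ)) *
          (1 - qG ^ ((6 : ℕ) : ℤ))) := by
    repeat rw [Finset.prod_insert (by decide)]
    simp only [Finset.prod_singleton, mG2, G2Short, Finset.mem_insert, Finset.mem_singleton,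
      Prod.mk.injEq]
    simp only [Int.reduceEq, Int.reduceNeg, Int.reduceAdd, Int.reduceMul, and_true, and_false,
      or_true, or_false, if_true, if_false, Nat.cast_ofNat, neg_neg]
    ring
  simp only [hprod, one_sub_qG_zpow_neg, one_sub_qG_zpow]
  repeat rw [Finset.prod_insert (by decide)]
  rw [Finset.prod_singleton]
  have := qG_ne_zero
  field_simp

theorem statement16 :
    G2Roots.filter (fun α => evG2 qG (qG ^ 3) α = qG ^ (-mG2 α)) =
        ({(-1, 0), (0, -1)} : Finset (ℤ × ℤ)) ∧
      G2Roots.filter (fun α => evG2 qG (qG ^ 3) α = 1) = ∅ ∧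
      ∃ ε₀ : Kq, (ε₀ = 1 ∨ ε₀ = -1) ∧ ∃ k : ℤ,
        ResG2 qG (qG ^ 3) =
          ε₀ * qG ^ k * (Φ 5 * Φ 9) / (Φ 2 ^ 2 * Φ 3 ^ 2 * Φ 6 ^ 2 * Φ 12) := by
  refine ⟨filter_evG2_eq_qG_zpow, filter_evG2_eq_one, 1, .inl rfl, 14, ?_⟩
  have h {n : ℕ} (s : Finset ℕ) (hn : 0 < n) (hs : n.divisors = s) :
      qG ^ n - 1 = ∏ d ∈ s, Φ d := hs ▸ (prod_Φ_divisors hn).symm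
  have h1 : qG - 1 = ∏ d ∈ {1}, Φ d := by
    simpa using h {1} one_pos (by decide)
  have h2 := h {1, 2} two_pos (by decide)
  have h3 := h {1, 3} three_pos (by decide)
  have h4 := h {1, 2, 4} four_pos (by decide)
  have h5 := h {1, 5} (n := 5) (by decide) (by decide)
  have h6 := h {1, 2, 3, 6} (n := 6) (by decide) (by decide)
  have h9 := h {1, 3, 9} (n := 9) (by decide) (by decide)
  have h12 := h {1, 2, 3, 4, 6, 12} (n := 12) (by decide) (by decide)
  rw [ResG2, filter_evG2_ne_one, filter_evG2_ne_qG_zpow, prod_one_sub_evG2_inv,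
    prod_one_sub_qG_zpow_mul_evG2_inv, pow_one, h1, h2, h3, h4, h5, h6, h9, h12]
  repeat rw [Finset.prod_insert (by decide)]
  simp only [Finset.prod_singleton]
  have := qG_ne_zero
  have := Φ_ne_zero (n := 1) (by decide)
  have := Φ_ne_zero (n := 2) (by decide)
  have := Φ_ne_zero (n := 3) (by decide)
  have := Φ_ne_zero (n := 4) (by decide)
  have := Φ_ne_zero (n := 5) (by decide)
  have := Φ_ne_zero (n := 6) (by decide)
  have := Φ_ne_zero (n := 9) (by decide)
  have := Φ_ne_zero (n := 12) (by decide)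
  norm_cast
  field_simp
end
end
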